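/- arXiv:1103.3862 — 8 statements merged into one kernel-verified Lean document; each statement's English description precedes it below -/
import Mathlib

section
/- Let T be a compact metric space and x̄ ∈ Ω. Assume that the function t ↦ g_t(x̄) is upper semicontinuous on T, that ∇h(x̄) : X → Y is surjective, and that there exists x̃ ∈ X such that ∇h(x̄)x̃ = 0, the function t ↦ ⟨∇g_t(x̄), x̃⟩ is upper semicontinuous on T, and ⟨∇g_t(x̄), x̃⟩ < 0 for all t ∈ T(x̄). Then the PMFCQ holds at x̄, i.e. inf_{ε>0} sup_{t∈T_ε(x̄)} ⟨∇g_t(x̄), x̃⟩ < 0. -/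
open Filter Topology Set Pointwise

section Defs

variable {X : Type*} [NormedAddCommGroup X] [NormedSpace ℝ X]

/-- The canonical identification of the dual of `X` with its weak* dual. -/
def toWD (p : X →L[ℝ] ℝ) : WeakDual ℝ X := p

/-- The weak* closure of a subset of the dual. -/
def wkClosure (S : Set (X →L[ℝ] ℝ)) : Set (X →L[ℝ] ℝ) :=
  {p | toWD p ∈ closure (toWD '' S)}

/-- A subset of the dual is weak* closed. -/
def IsWeakStarClosed (S : Set (X →L[ℝ] ℝ)) : Prop :=
  IsClosed (toWD '' S)

/-- A subset of `X* × ℝ` is weak* closed. -/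
def IsWeakStarClosedProd (S : Set ((X →L[ℝ] ℝ) × ℝ)) : Prop :=
  IsClosed ((fun p : (X →L[ℝ] ℝ) × ℝ => (toWD p.1, p.2)) '' S)

/-- The convex conic hull of `S ∪ {0}`: all finite nonnegative combinations of elements of `S`. -/
def coneHull {E : Type*} [AddCommMonoid E] [Module ℝ E] (S : Set E) : Set E :=
  {x | ∃ (n : ℕ) (c : Fin n → ℝ) (v : Fin n → E),
    (∀ i, 0 ≤ c i) ∧ (∀ i, v i ∈ S) ∧ x = ∑ i, c i • v i}

/-- The set of ε-normals to `Ω` at `x`. -/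
def epsNormal (Ω : Set X) (x : X) (ε : ℝ) : Set (X →L[ℝ] ℝ) :=
  {p | ∀ γ > (0:ℝ), ∃ δ > (0:ℝ), ∀ u ∈ Ω, ‖u - x‖ < δ → p (u - x) ≤ (ε + γ) * ‖u - x‖}

/-- The Fréchet (regular) normal cone to `Ω` at `x`. -/
def frechetNormal (Ω : Set X) (x : X) : Set (X →L[ℝ] ℝ) := epsNormal Ω x 0

/-- The limiting (Mordukhovich) normal cone to `Ω` at `xb`. -/
def limitingNormal (Ω : Set X) (xb : X) : Set (X →L[ℝ] ℝ) :=
  {p | ∃ (ε : ℕ → ℝ) (xs : ℕ → X) (ps : ℕ → X →L[ℝ] ℝ),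
    (∀ n, 0 ≤ ε n) ∧ Tendsto ε atTop (𝓝 0) ∧
    (∀ n, xs n ∈ Ω) ∧ Tendsto xs atTop (𝓝 xb) ∧
    (∀ n, ps n ∈ epsNormal Ω (xs n) (ε n)) ∧
    (∀ v : X, Tendsto (fun n => ps n v) atTop (𝓝 (p v)))}

/-- The normal cone of convex analysis to `Ω` at `xb`. -/
def convexNormal (Ω : Set X) (xb : X) : Set (X →L[ℝ] ℝ) :=
  {p | ∀ x ∈ Ω, p (x - xb) ≤ 0}

/-- The subdifferential of convex analysis of `f` at `xb`. -/
def convexSubdiff (f : X → ℝ) (xb : X) : Set (X →L[ℝ] ℝ) :=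
  {p | ∀ x, f xb + p (x - xb) ≤ f x}

variable {Y : Type*} [NormedAddCommGroup Y] [NormedSpace ℝ Y]

/-- The image `A*(Y*)` of the adjoint operator `A* : Y* → X*`. -/
def adjRange (A : X →L[ℝ] Y) : Set (X →L[ℝ] ℝ) :=
  Set.range fun q : Y →L[ℝ] ℝ => q.comp A

variable {T : Type*}

/-- Uniform Fréchet differentiability of the family `g = (g t)` at `xb`:
`s(η) := sup_t sup_{x ∈ B_η(xb), x ≠ xb} |g t x - g t xb - ⟨dg t, x - xb⟩|/‖x - xb‖ → 0` as `η ↓ 0`. -/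
def UnifFrechetDiffAt (g : T → X → ℝ) (dg : T → X →L[ℝ] ℝ) (xb : X) : Prop :=
  ∀ ε > (0:ℝ), ∃ η > (0:ℝ), ∀ t : T, ∀ x : X, ‖x - xb‖ ≤ η →
    |g t x - g t xb - dg t (x - xb)| ≤ ε * ‖x - xb‖

/-- Uniform strict differentiability of the family `g = (g t)` at `xb`:
`r(η) := sup_t sup_{x,x' ∈ B_η(xb), x ≠ x'} |g t x - g t x' - ⟨dg t, x - x'⟩|/‖x - x'‖ → 0`
as `η ↓ 0`. -/
def UnifStrictDiffAt (g : T → X → ℝ) (dg : T → X →L[ℝ] ℝ) (xb : X) : Prop :=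
  ∀ ε > (0:ℝ), ∃ η > (0:ℝ), ∀ t : T, ∀ x x' : X, ‖x - xb‖ ≤ η → ‖x' - xb‖ ≤ η →
    |g t x - g t x' - dg t (x - x')| ≤ ε * ‖x - x'‖

/-- The inequality part of the PMFCQ at `xb` with the direction `xt`:
`inf_{ε>0} sup_{t ∈ T_ε(xb)} ⟨dg t, xt⟩ < 0`, where `T_ε(xb) = {t | g t xb ≥ -ε}`. -/
def PMFCQat (g : T → X → ℝ) (dg : T → X →L[ℝ] ℝ) (xb xt : X) : Prop :=
  ∃ ε > (0:ℝ), ∃ δ > (0:ℝ), ∀ t : T, -ε ≤ g t xb → dg t xt ≤ -δ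

end Defs

/-- For a compact metric index space `T`, upper semicontinuity of `t ↦ g t xb` and
of `t ↦ ⟨dg t, xt⟩`, surjectivity of `∇h(xb)`, together with `∇h(xb) xt = 0` and
`⟨dg t, xt⟩ < 0` for every active index `t`, imply the PMFCQ inequality
`inf_{ε>0} sup_{t ∈ T_ε(xb)} ⟨dg t, xt⟩ < 0` at `xb`. -/
theorem statement1 {X Y T : Type*} [NormedAddCommGroup X] [NormedSpace ℝ X] [CompleteSpace X]
    [NormedAddCommGroup Y] [NormedSpace ℝ Y] [CompleteSpace Y]
    [MetricSpace T] [CompactSpace T]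
    (g : T → X → ℝ) (dg : T → X →L[ℝ] ℝ) (h : X → Y) (dh : X →L[ℝ] Y) (xb xt : X)
    (hgd : ∀ t : T, HasFDerivAt (g t) (dg t) xb)
    (hhd : HasStrictFDerivAt h dh xb)
    (hbd : ∃ M : ℝ, ∀ t : T, ‖dg t‖ ≤ M)
    (hfeas : h xb = 0 ∧ ∀ t : T, g t xb ≤ 0)
    (husc : UpperSemicontinuous fun t : T => g t xb)
    (hsurj : Function.Surjective dh)
    (hxt : dh xt = 0)
    (husc' : UpperSemicontinuous fun t : T => dg t xt)
    (hneg : ∀ t : T, g t xb = 0 → dg t xt < 0) :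
    PMFCQat g dg xb xt := by
  have key : ∃ ε > (0:ℝ), ∃ δ > (0:ℝ), ∀ t ∈ (Set.univ : Set T), -ε ≤ g t xb → dg t xt ≤ -δ := by
    refine isCompact_univ.induction_on
      (p := fun s : Set T => ∃ ε > (0:ℝ), ∃ δ > (0:ℝ), ∀ t ∈ s, -ε ≤ g t xb → dg t xt ≤ -δ)
      ⟨1, one_pos, 1, one_pos, fun t ht => absurd ht (Set.notMem_empty t)⟩ ?_ ?_ ?_
    · rintro s s' hss ⟨ε, hε, δ, hδ, H⟩
      exact ⟨ε, hε, δ, hδ, fun t ht => H t (hss ht)⟩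
    · rintro s s' ⟨ε, hε, δ, hδ, H⟩ ⟨ε', hε', δ', hδ', H'⟩
      refine ⟨min ε ε', lt_min hε hε', min δ δ', lt_min hδ hδ', ?_⟩
      intro t ht hg
      have h1 := min_le_left ε ε'
      have h2 := min_le_right ε ε'
      have h3 := min_le_left δ δ'
      have h4 := min_le_right δ δ'
      rcases ht with ht | ht
      · have := H t ht (by linarith)
        linarith
      · have := H' t ht (by linarith)
        linarith
    · intro t _
      rcases (hfeas.2 t).lt_or_eq with hlt | heq
      · have hev := husc t (g t xb / 2) (by show g t xb < _; linarith)
        refine ⟨_, mem_nhdsWithin_of_mem_nhds hev, -(g t xb / 2), by linarith, 1, one_pos, ?_⟩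
        intro s hs hg
        have hs' : g s xb < g t xb / 2 := hs
        linarith
      · have hn := hneg t heq
        have hev := husc' t (dg t xt / 2) (by show dg t xt < _; linarith)
        refine ⟨_, mem_nhdsWithin_of_mem_nhds hev, 1, one_pos, -(dg t xt / 2), by linarith, ?_⟩
        intro s hs _
        have hs' : dg s xt < dg t xt / 2 := hs
        linarith
  obtain ⟨ε, hε, δ, hδ, H⟩ := key
  exact ⟨ε, hε, δ, hδ, fun t => H t (Set.mem_univ t)⟩
end

section
/- Assume that all the functions g_t, t ∈ T, are convex and uniformly Fréchet differentiable at x̄ ∈ Ω, and that h = A is a surjective continuous linear operator from X to Y. Then the PMFCQ holds at x̄ if and only if the strong Slater condition (SSC) holds: there exists x̂ ∈ X such that A x̂ = 0 and sup_{t∈T} g_t(x̂) < 0. -/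
open Filter Topology Set Pointwise

/-- For convex, uniformly Fréchet differentiable functions `g t` and a surjective
continuous linear operator `A`, the PMFCQ at a feasible point `xb` is equivalent to the strong
Slater condition: there is `xh` with `A xh = 0` and `sup_t g t xh < 0`. -/
theorem statement2 {X Y T : Type*} [NormedAddCommGroup X] [NormedSpace ℝ X] [CompleteSpace X]
    [NormedAddCommGroup Y] [NormedSpace ℝ Y] [CompleteSpace Y]
    (g : T → X → ℝ) (dg : T → X →L[ℝ] ℝ) (A : X →L[ℝ] Y) (xb : X)
    (hconv : ∀ t : T, ConvexOn ℝ univ (g t))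
    (hgd : ∀ t : T, HasFDerivAt (g t) (dg t) xb)
    (hbd : ∃ M : ℝ, ∀ t : T, ‖dg t‖ ≤ M)
    (hunif : UnifFrechetDiffAt g dg xb)
    (hsurj : Function.Surjective A)
    (hfeas : A xb = 0 ∧ ∀ t : T, g t xb ≤ 0) :
    (∃ xt : X, A xt = 0 ∧ PMFCQat g dg xb xt) ↔
      (∃ xh : X, A xh = 0 ∧ ∃ δ > (0:ℝ), ∀ t : T, g t xh ≤ -δ) := by
  obtain ⟨hA, hg0⟩ := hfeas
  -- uniform expansion along a direction
  have key : ∀ d : X, ∀ c > (0:ℝ), ∃ l0 > (0:ℝ), ∀ l : ℝ, 0 < l → l ≤ l0 → ∀ t : T,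
      |g t (xb + l • d) - g t xb - l * dg t d| ≤ l * c := by
    intro d c hc
    have hd : 0 < ‖d‖ + 1 := by positivity
    obtain ⟨η, hη, H⟩ := hunif (c / (‖d‖ + 1)) (by positivity)
    refine ⟨η / (‖d‖ + 1), by positivity, fun l hl hl0 t => ?_⟩
    have e1 : xb + l • d - xb = l • d := by abel
    have e2 : ‖l • d‖ = l * ‖d‖ := by rw [norm_smul, Real.norm_of_nonneg hl.le]
    rw [le_div_iff₀ hd] at hl0
    have h1 := H t (xb + l • d) (by rw [e1, e2]; nlinarith)
    rw [e1, e2, map_smul, smul_eq_mul] at h1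
    refine h1.trans ?_
    rw [div_mul_eq_mul_div, div_le_iff₀ hd]
    have : 0 < l * c := by positivity
    nlinarith
  constructor
  · rintro ⟨xt, hxt, ε, hε, δ, hδ, hP⟩
    obtain ⟨M, hM⟩ := hbd
    obtain ⟨l0, hl0, H⟩ := key xt (δ / 2) (by positivity)
    have hK : 0 < |M| * ‖xt‖ + δ / 2 := by positivity
    set K := |M| * ‖xt‖ + δ / 2 with hKdef
    set l := min l0 (ε / 2 / K) with hl
    have hlpos : 0 < l := lt_min hl0 (by positivity)
    have hlK : l * K ≤ ε / 2 := (le_div_iff₀ hK).1 (min_le_right _ _)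
    refine ⟨xb + l • xt, by simp [hA, hxt], min (l * (δ / 2)) (ε / 2),
      lt_min (by positivity) (by positivity), fun t => ?_⟩
    have h1 := (abs_le.1 (H l hlpos (min_le_left _ _) t)).2
    by_cases ht : -ε ≤ g t xb
    · have h2 := mul_le_mul_of_nonneg_left (hP t ht) hlpos.le
      have h3 := min_le_left (l * (δ / 2)) (ε / 2)
      have h4 := hg0 t
      linarith
    · push Not at ht
      have h3 := min_le_right (l * (δ / 2)) (ε / 2)
      have h4 : dg t xt ≤ |M| * ‖xt‖ :=
        (le_abs_self _).trans (((dg t).le_opNorm xt).trans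
          (mul_le_mul_of_nonneg_right ((hM t).trans (le_abs_self M)) (norm_nonneg _)))
      have h5 := mul_le_mul_of_nonneg_left h4 hlpos.le
      have h6 : l * K = l * (|M| * ‖xt‖) + l * (δ / 2) := by rw [hKdef]; ring
      linarith
  · rintro ⟨xh, hxh, δ, hδ, hS⟩
    refine ⟨xh - xb, by simp [hA, hxh], δ / 2, by positivity, δ / 4, by positivity,
      fun t ht => ?_⟩
    obtain ⟨l0, hl0, H⟩ := key (xh - xb) (δ / 4) (by positivity)
    set l := min l0 1 with hl
    have hlpos : 0 < l := lt_min hl0 one_pos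
    have hl1 : l ≤ 1 := min_le_right _ _
    have h1 := (abs_le.1 (H l hlpos (min_le_left _ _) t)).1
    have h2 := (hconv t).2 (mem_univ xb) (mem_univ xh) (sub_nonneg.2 hl1) hlpos.le (by ring)
    have e : (1 - l) • xb + l • xh = xb + l • (xh - xb) := by module
    rw [e, smul_eq_mul, smul_eq_mul] at h2
    have h3 := hS t
    have h4 : l * dg t (xh - xb) ≤ l * (-(δ / 4)) := by nlinarith
    exact le_of_mul_le_mul_left h4 hlpos
end

section
/- Consider the pure inequality system (h = 0 absent) with a FINITE index set T, and let x̄ be feasible (g_t(x̄) ≤ 0 for all t ∈ T). If the Mangasarian–Fromovitz constraint qualification holds at x̄, i.e. there exists x̃ ∈ X with ⟨∇g_t(x̄), x̃⟩ < 0 for all t ∈ T(x̄), then the NFMCQ holds at x̄: the cone cone{(∇g_t(x̄), ⟨∇g_t(x̄), x̄⟩ − g_t(x̄)) : t ∈ T} is weak* closed in X* × ℝ. -/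
open Filter Topology Set Pointwise

theorem cone_closed_aux {E T : Type*} [AddCommGroup E] [Module ℝ E] [TopologicalSpace E]
    [IsTopologicalAddGroup E] [ContinuousSMul ℝ E] [T2Space E] [Fintype T]
    (v : T → E) (φ : E →L[ℝ] ℝ) (hφ : ∀ t, 0 < φ (v t)) :
    IsClosed {x : E | ∃ c : T → ℝ, (∀ t, 0 ≤ c t) ∧ x = ∑ t, c t • v t} := by
  set K := {x : E | ∃ c : T → ℝ, (∀ t, 0 ≤ c t) ∧ x = ∑ t, c t • v t} with hK
  refine isClosed_of_closure_subset fun y hy => ?_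
  let M : ℝ := φ y + 1
  let C : Set (T → ℝ) := Set.Icc 0 (fun t => M / φ (v t))
  let F : (T → ℝ) → E := fun c => ∑ t, c t • v t
  have hF : Continuous F := by fun_prop
  have hC : IsClosed (F '' C) := ((isCompact_Icc : IsCompact C).image hF).isClosed
  have hU : IsOpen {z : E | φ z < M} := isOpen_lt φ.continuous continuous_const
  have hyU : y ∈ {z : E | φ z < M} := by simp [M]
  have h1 : y ∈ closure ({z : E | φ z < M} ∩ K) := hU.inter_closure ⟨hyU, hy⟩
  have hsub : {z : E | φ z < M} ∩ K ⊆ F '' C := by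
    rintro z ⟨hz, c, hc, rfl⟩
    refine ⟨c, ⟨fun t => hc t, fun t => ?_⟩, rfl⟩
    rw [le_div_iff₀ (hφ t)]
    have h2 : φ (∑ t, c t • v t) = ∑ t, c t * φ (v t) := by simp
    have h3 : c t * φ (v t) ≤ ∑ t, c t * φ (v t) :=
      Finset.single_le_sum (f := fun t => c t * φ (v t))
        (fun i _ => mul_nonneg (hc i) (hφ i).le) (Finset.mem_univ t)
    have hz' : φ (∑ t, c t • v t) < M := hz
    linarith
  obtain ⟨c, hc, hcy⟩ := closure_minimal hsub hC h1
  exact ⟨c, fun t => hc.1 t, hcy.symm⟩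

theorem coneHull_range_aux {E T : Type*} [AddCommGroup E] [Module ℝ E] [Fintype T] (v : T → E) :
    coneHull (Set.range v) = {x : E | ∃ c : T → ℝ, (∀ t, 0 ≤ c t) ∧ x = ∑ t, c t • v t} := by
  classical
  ext x
  constructor
  · rintro ⟨n, c, w, hc, hw, rfl⟩
    choose τ hτ using hw
    refine ⟨fun t => ∑ i, if τ i = t then c i else 0, fun t => ?_, ?_⟩
    · exact Finset.sum_nonneg fun i _ => by split_ifs <;> simp [hc]
    · simp_rw [Finset.sum_smul]
      rw [Finset.sum_comm]
      simp [ite_smul, hτ]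
  · rintro ⟨c, hc, rfl⟩
    refine ⟨Fintype.card T, fun i => c ((Fintype.equivFin T).symm i),
      fun i => v ((Fintype.equivFin T).symm i), fun i => hc _, fun i => ⟨_, rfl⟩, ?_⟩
    exact ((Fintype.equivFin T).symm.sum_comp (fun t => c t • v t)).symm

/-- For a finite index set `T` and a feasible point `xb` of the inequality system
`g t x ≤ 0`, the Mangasarian–Fromovitz constraint qualification at `xb` implies the NFMCQ:
the convex conic hull of `{(dg t, ⟨dg t, xb⟩ - g t xb) : t ∈ T}` is weak* closed in `X* × ℝ`. -/
theorem statement3 {X T : Type*} [NormedAddCommGroup X] [NormedSpace ℝ X] [CompleteSpace X]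
    [Finite T]
    (g : T → X → ℝ) (dg : T → X →L[ℝ] ℝ) (xb : X)
    (hgd : ∀ t : T, HasFDerivAt (g t) (dg t) xb)
    (hbd : ∃ M : ℝ, ∀ t : T, ‖dg t‖ ≤ M)
    (hfeas : ∀ t : T, g t xb ≤ 0)
    (hmfcq : ∃ xt : X, ∀ t : T, g t xb = 0 → dg t xt < 0) :
    IsWeakStarClosedProd (coneHull (Set.range fun t : T => (dg t, dg t xb - g t xb))) := by
  obtain ⟨xt, hxt⟩ := hmfcq
  have := Fintype.ofFinite T
  -- a small step making every generator strictly negative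
  have hs : ∃ s > (0:ℝ), ∀ t, s * dg t xt + g t xb < 0 := by
    have key : ∀ᶠ s in 𝓝[>] (0:ℝ), ∀ t, s * dg t xt + g t xb < 0 := by
      rw [Filter.eventually_all]
      intro t
      rcases (hfeas t).lt_or_eq with h | h
      · have hcont : ContinuousAt (fun s : ℝ => s * dg t xt + g t xb) 0 := by fun_prop
        have := hcont.eventually_lt (continuousAt_const (y := (0:ℝ))) (by simpa using h)
        exact this.filter_mono nhdsWithin_le_nhds
      · filter_upwards [self_mem_nhdsWithin] with s hs
        have hs' : 0 < s := hs
        rw [h, add_zero]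
        exact mul_neg_of_pos_of_neg hs' (hxt t h)
    obtain ⟨s, h1, h2⟩ := (key.and self_mem_nhdsWithin).exists
    exact ⟨s, h2, h1⟩
  obtain ⟨s, -, hs⟩ := hs
  let ev : WeakDual ℝ X →L[ℝ] ℝ :=
    { toFun := fun p => p (xb + s • xt)
      map_add' := fun p q => rfl
      map_smul' := fun c p => rfl
      cont := WeakDual.eval_continuous _ }
  let φ : (WeakDual ℝ X × ℝ) →L[ℝ] ℝ :=
    ContinuousLinearMap.snd ℝ (WeakDual ℝ X) ℝ - ev.comp (ContinuousLinearMap.fst ℝ (WeakDual ℝ X) ℝ)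
  have hcl := cone_closed_aux (fun t : T => ((toWD (dg t), dg t xb - g t xb) : WeakDual ℝ X × ℝ)) φ
    (fun t => by
      have h1 : φ (toWD (dg t), dg t xb - g t xb) = (dg t xb - g t xb) - dg t (xb + s • xt) := rfl
      rw [h1, map_add, map_smul, smul_eq_mul]
      linarith [hs t])
  unfold IsWeakStarClosedProd
  rw [coneHull_range_aux]
  let L : ((X →L[ℝ] ℝ) × ℝ) →ₗ[ℝ] (WeakDual ℝ X × ℝ) :=
    { toFun := fun p => (toWD p.1, p.2)
      map_add' := fun p q => rfl
      map_smul' := fun c p => rfl }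
  have hL : ∀ c : T → ℝ, L (∑ t, c t • (dg t, dg t xb - g t xb))
      = ∑ t, c t • ((toWD (dg t), dg t xb - g t xb) : WeakDual ℝ X × ℝ) := by
    intro c
    rw [map_sum]
    rfl
  convert hcl using 1
  ext z
  constructor
  · rintro ⟨_, ⟨c, hc, rfl⟩, rfl⟩
    exact ⟨c, hc, hL c⟩
  · rintro ⟨c, hc, rfl⟩
    exact ⟨_, ⟨c, hc, rfl⟩, hL c⟩
end

section
/- Consider the pure inequality system (h = 0 absent) with X finite-dimensional, and let x̄ be feasible (g_t(x̄) ≤ 0 for all t ∈ T). Assume that the set {(∇g_t(x̄), ⟨∇g_t(x̄), x̄⟩ − g_t(x̄)) : t ∈ T} is compact in X* × ℝ and that the PMFCQ holds at x̄, i.e. there exists x̃ ∈ X with inf_{ε>0} sup_{t∈T_ε(x̄)} ⟨∇g_t(x̄), x̃⟩ < 0. Then the NFMCQ holds at x̄: cone{(∇g_t(x̄), ⟨∇g_t(x̄), x̄⟩ − g_t(x̄)) : t ∈ T} is closed in X* × ℝ. -/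
open Filter Topology Set Pointwise

theorem convexHull_compact_aux {E : Type*} [NormedAddCommGroup E] [NormedSpace ℝ E]
    [FiniteDimensional ℝ E] (S : Set E) (hS : IsCompact S) : IsCompact (convexHull ℝ S) := by
  rcases S.eq_empty_or_nonempty with rfl | ⟨v0, hv0⟩
  · simp
  let d := Module.finrank ℝ E + 1
  have hc : IsCompact ((fun p : (Fin d → ℝ) × (Fin d → E) => ∑ i, p.1 i • p.2 i) ''
      (stdSimplex ℝ (Fin d) ×ˢ Set.univ.pi fun _ => S)) :=
    ((isCompact_stdSimplex ℝ (Fin d)).prod (isCompact_univ_pi fun _ => hS)).image (by fun_prop)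
  convert hc using 1
  ext x
  constructor
  · intro hx
    obtain ⟨ι, _, z, w, hz, hai, hw, hw1, rfl⟩ := eq_pos_convex_span_of_mem_convexHull hx
    have hcard : Fintype.card ι ≤ Fintype.card (Fin d) := by
      rw [Fintype.card_fin]
      exact hai.card_le_finrank_succ.trans
        (Nat.succ_le_succ (Submodule.finrank_le _))
    obtain ⟨e⟩ := Function.Embedding.nonempty_of_card_le hcard
    have hw' : ∀ j, j ∉ Set.range e → Function.extend e w 0 j = 0 := fun j hj =>
      Function.extend_apply' _ _ _ hj
    refine ⟨(Function.extend e w 0, Function.extend e z fun _ => v0), ⟨⟨?_, ?_⟩, ?_⟩, ?_⟩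
    · intro j
      by_cases hj : j ∈ Set.range e
      · obtain ⟨i, rfl⟩ := hj
        simp only [e.injective.extend_apply]
        exact (hw i).le
      · exact (hw' j hj).ge
    · rw [← hw1]
      symm
      refine Fintype.sum_of_injective e e.injective _ _ hw' fun i => ?_
      simp only [e.injective.extend_apply]
    · intro j _
      by_cases hj : j ∈ Set.range e
      · obtain ⟨i, rfl⟩ := hj
        simp only [e.injective.extend_apply]
        exact hz ⟨i, rfl⟩
      · simp only [Function.extend_apply' _ _ _ hj]
        exact hv0
    · symm
      refine Fintype.sum_of_injective e e.injective _ _ ?_ fun i => ?_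
      · intro j hj
        simp only [hw' j hj, zero_smul]
      · simp only [e.injective.extend_apply]
  · rintro ⟨⟨w, z⟩, ⟨⟨hw, hw1⟩, hz⟩, rfl⟩
    exact mem_convexHull_of_exists_fintype w z hw hw1 (fun i => hz i trivial) rfl

theorem coneHull_closed_aux {E : Type*} [NormedAddCommGroup E] [NormedSpace ℝ E]
    [FiniteDimensional ℝ E] (S : Set E) (hS : IsCompact S) (φ : E →L[ℝ] ℝ) (m : ℝ)
    (hm : 0 < m) (hφ : ∀ v ∈ S, φ v ≤ -m) : IsClosed (coneHull S) := by
  rcases S.eq_empty_or_nonempty with rfl | ⟨v0, hv0⟩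
  · have : coneHull (∅ : Set E) = {0} := by
      ext x
      constructor
      · rintro ⟨n, c, v, -, hv, rfl⟩
        rw [Set.mem_singleton_iff]
        exact Finset.sum_eq_zero fun i _ => absurd (hv i) (Set.notMem_empty _)
      · rintro rfl
        exact ⟨0, Fin.elim0, Fin.elim0, fun i => i.elim0, fun i => i.elim0, by simp⟩
    rw [this]
    exact isClosed_singleton
  have hK : IsCompact (convexHull ℝ S) := convexHull_compact_aux S hS
  have hφK : ∀ v ∈ convexHull ℝ S, φ v ≤ -m := by
    intro v hv
    have hc : Convex ℝ {v : E | φ v ≤ -m} :=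
      convex_halfSpace_le φ.toLinearMap.isLinear (-m)
    exact convexHull_min (fun v hv => hφ v hv) hc hv
  have h1 : ∀ x ∈ coneHull S, ∃ c : ℝ, 0 ≤ c ∧ ∃ v ∈ convexHull ℝ S, x = c • v := by
    rintro x ⟨n, c, v, hc, hv, rfl⟩
    rcases (Finset.sum_nonneg fun i (_ : i ∈ Finset.univ) => hc i).eq_or_lt with h | h
    · refine ⟨0, le_rfl, v0, subset_convexHull ℝ S hv0, ?_⟩
      have := (Finset.sum_eq_zero_iff_of_nonneg fun i (_ : i ∈ Finset.univ) => hc i).1 h.symm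
      rw [zero_smul]
      exact Finset.sum_eq_zero fun i hi => by rw [this i hi, zero_smul]
    · refine ⟨∑ i, c i, h.le, Finset.univ.centerMass c v, ?_, ?_⟩
      · exact Finset.centerMass_mem_convexHull _ (fun i _ => hc i) h (fun i _ => hv i)
      · rw [Finset.centerMass, smul_smul, mul_inv_cancel₀ h.ne', one_smul]
  have h2 : ∀ c : ℝ, 0 ≤ c → ∀ v ∈ convexHull ℝ S, c • v ∈ coneHull S := by
    intro c hc v hv
    rw [mem_convexHull_iff_exists_fintype] at hv
    obtain ⟨ι, _, w, z, hw, -, hz, rfl⟩ := hv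
    let e := (Fintype.equivFin ι).symm
    refine ⟨Fintype.card ι, fun i => c * w (e i), fun i => z (e i),
      fun i => mul_nonneg hc (hw _), fun i => hz _, ?_⟩
    rw [Finset.smul_sum, ← e.sum_comp]
    simp only [smul_smul]
  refine isClosed_of_closure_subset fun x hx => ?_
  let B := (-φ x + 1) / m
  let K : Set E := (fun p : ℝ × E => p.1 • p.2) '' (Set.Icc 0 B ×ˢ convexHull ℝ S)
  have hKc : IsCompact K := (isCompact_Icc.prod hK).image (by fun_prop)
  have hU : IsOpen {y : E | φ x - 1 < φ y} := isOpen_lt continuous_const φ.continuous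
  have hx' : x ∈ closure ({y : E | φ x - 1 < φ y} ∩ coneHull S) :=
    hU.inter_closure ⟨by simp, hx⟩
  have hsub : {y : E | φ x - 1 < φ y} ∩ coneHull S ⊆ K := by
    rintro y ⟨hy, hyC⟩
    obtain ⟨c, hc, v, hv, rfl⟩ := h1 y hyC
    refine ⟨(c, v), ⟨⟨hc, ?_⟩, hv⟩, rfl⟩
    simp only [Set.mem_ofPred_eq, map_smul, smul_eq_mul] at hy
    have := mul_le_mul_of_nonneg_left (hφK v hv) hc
    show c ≤ (-φ x + 1) / m
    rw [le_div_iff₀ hm]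
    linarith
  obtain ⟨⟨c, v⟩, ⟨⟨hc, -⟩, hv⟩, rfl⟩ := closure_minimal hsub hKc.isClosed hx'
  exact h2 c hc v hv

/-- For the pure inequality system in a finite-dimensional space `X`, if the set
`{(dg t, ⟨dg t, xb⟩ - g t xb) : t ∈ T}` is compact in `X* × ℝ` and the PMFCQ holds at the
feasible point `xb`, then the NFMCQ holds: the convex conic hull of that set is closed. -/
theorem statement4 {X T : Type*} [NormedAddCommGroup X] [NormedSpace ℝ X]
    [FiniteDimensional ℝ X]
    (g : T → X → ℝ) (dg : T → X →L[ℝ] ℝ) (xb : X)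
    (hgd : ∀ t : T, HasFDerivAt (g t) (dg t) xb)
    (hbd : ∃ M : ℝ, ∀ t : T, ‖dg t‖ ≤ M)
    (hfeas : ∀ t : T, g t xb ≤ 0)
    (hcomp : IsCompact (Set.range fun t : T => (dg t, dg t xb - g t xb)))
    (hpmfcq : ∃ xt : X, PMFCQat g dg xb xt) :
    IsClosed (coneHull (Set.range fun t : T => (dg t, dg t xb - g t xb))) := by
  obtain ⟨xt, ε, hε, δ, hδ, h⟩ := hpmfcq
  obtain ⟨M, hM⟩ := hbd
  let N := |M| * ‖xt‖ + 1
  have hN : 0 < N := by positivity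
  let s := ε / (2 * N)
  have hs : 0 < s := by positivity
  have hsN : s * N = ε / 2 := by
    show ε / (2 * N) * N = ε / 2
    field_simp
  let φ : ((X →L[ℝ] ℝ) × ℝ) →L[ℝ] ℝ :=
    (ContinuousLinearMap.apply ℝ ℝ (xb + s • xt)).comp
      (ContinuousLinearMap.fst ℝ (X →L[ℝ] ℝ) ℝ) - ContinuousLinearMap.snd ℝ (X →L[ℝ] ℝ) ℝ
  refine coneHull_closed_aux _ hcomp φ (min (ε / 2) (s * δ)) (by positivity) ?_
  rintro _ ⟨t, rfl⟩
  have hφ : φ (dg t, dg t xb - g t xb) = g t xb + s * dg t xt := by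
    simp [φ]
    ring
  rw [hφ]
  by_cases ht : -ε ≤ g t xb
  · have h1 := mul_le_mul_of_nonneg_left (h t ht) hs.le
    have h2 := min_le_right (ε / 2) (s * δ)
    have h3 := hfeas t
    linarith
  · have h1 : dg t xt ≤ N := by
      have a := (le_abs_self _).trans ((dg t).le_opNorm xt)
      have b := mul_le_mul_of_nonneg_right ((hM t).trans (le_abs_self M)) (norm_nonneg xt)
      show _ ≤ |M| * ‖xt‖ + 1
      linarith
    have h2 := mul_le_mul_of_nonneg_left h1 hs.le
    have h3 := min_le_left (ε / 2) (s * δ)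
    linarith
end

section
/- Consider the pure inequality system (h = 0 absent) with X finite-dimensional and T a compact metric space, and let x̄ be feasible (g_t(x̄) ≤ 0 for all t ∈ T). Assume that the mappings t ↦ g_t(x̄) and t ↦ ∇g_t(x̄) are continuous on T and that the EMFCQ holds at x̄, i.e. there exists x̃ ∈ X with ⟨∇g_t(x̄), x̃⟩ < 0 for all t ∈ T(x̄). Then the NFMCQ holds at x̄: cone{(∇g_t(x̄), ⟨∇g_t(x̄), x̄⟩ − g_t(x̄)) : t ∈ T} is closed in X* × ℝ. -/
open Filter Topology Set Pointwise

lemma coneHull_caratheodory {E T : Type*} [NormedAddCommGroup E] [NormedSpace ℝ E]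
    [FiniteDimensional ℝ E] [Nonempty T] (f : T → E) (x : E)
    (hx : x ∈ coneHull (Set.range f)) :
    ∃ (c : Fin (Module.finrank ℝ E + 1) → ℝ) (v : Fin (Module.finrank ℝ E + 1) → T),
      (∀ i, 0 ≤ c i) ∧ x = ∑ i, c i • f (v i) := by
  classical
  obtain ⟨n, c, v, hc, hv, rfl⟩ := hx
  obtain ⟨t0⟩ := ‹Nonempty T›
  by_cases hs : ∑ i, c i = 0
  · refine ⟨0, fun _ => t0, fun _ => le_rfl, ?_⟩
    have h0 : ∀ i, c i = 0 := fun i =>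
      (Finset.sum_eq_zero_iff_of_nonneg (fun i _ => hc i)).1 hs i (Finset.mem_univ i)
    simp [h0]
  have hspos : 0 < ∑ i, c i := lt_of_le_of_ne (Finset.sum_nonneg fun i _ => hc i) (Ne.symm hs)
  set s := ∑ i, c i with hsdef
  have hmem : ∑ i, (c i / s) • v i ∈ convexHull ℝ (Set.range f) := by
    apply (convex_convexHull ℝ (Set.range f)).sum_mem
    · intro i _
      exact div_nonneg (hc i) hspos.le
    · rw [← Finset.sum_div]
      exact div_self hs
    · intro i _
      exact subset_convexHull ℝ _ (hv i)
  obtain ⟨ι, hι, z, w, hz, haff, hw, hw1, hsum⟩ := eq_pos_convex_span_of_mem_convexHull hmem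
  have hcard : Fintype.card ι ≤ Fintype.card (Fin (Module.finrank ℝ E + 1)) := by
    rw [Fintype.card_fin]
    refine haff.card_le_finrank_succ.trans ?_
    exact Nat.succ_le_succ (Submodule.finrank_le _)
  obtain ⟨e⟩ := Function.Embedding.nonempty_of_card_le hcard
  choose u hu using fun i => hz (Set.mem_range_self i)
  refine ⟨Function.extend e (fun i => s * w i) 0, Function.extend e u (fun _ => t0), ?_, ?_⟩
  · intro j
    by_cases hj : ∃ i, e i = j
    · obtain ⟨i, rfl⟩ := hj
      rw [e.injective.extend_apply]
      exact mul_nonneg hspos.le (hw i).le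
    · rw [Function.extend_apply' _ _ _ hj]
      exact le_rfl
  · have h1 : ∑ i, c i • v i = s • ∑ i, w i • z i := by
      rw [hsum, Finset.smul_sum]
      refine Finset.sum_congr rfl fun i _ => ?_
      rw [smul_smul, mul_div_cancel₀ _ hs]
    rw [h1, Finset.smul_sum]
    refine Fintype.sum_of_injective e e.injective _ _ ?_ ?_
    · intro j hj
      rw [Function.extend_apply' _ _ _ (by simpa using hj)]
      simp
    · intro i
      rw [e.injective.extend_apply, e.injective.extend_apply, hu, smul_smul]

lemma coneHull_closed {E T : Type*} [NormedAddCommGroup E] [NormedSpace ℝ E]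
    [FiniteDimensional ℝ E] [TopologicalSpace T] [CompactSpace T] [Nonempty T]
    (f : T → E) (hf : Continuous f) (L : E →L[ℝ] ℝ) (hL : ∀ t, 0 < L (f t)) :
    IsClosed (coneHull (Set.range f)) := by
  obtain ⟨t1, -, ht1⟩ := isCompact_univ.exists_isMinOn (Set.univ_nonempty (α := T))
    (L.continuous.comp hf).continuousOn
  set δ := L (f t1) with hδ
  have hδ0 : 0 < δ := hL t1
  have hδle : ∀ t, δ ≤ L (f t) := fun t => ht1 (Set.mem_univ t)
  apply isClosed_of_closure_subset
  intro y hy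
  set R := (L y + 1) / δ
  let N := Module.finrank ℝ E + 1
  let F : (Fin N → ℝ) × (Fin N → T) → E := fun p => ∑ i, p.1 i • f (p.2 i)
  have hF : Continuous F := by
    refine continuous_finsetSum _ fun i _ => ?_
    exact ((continuous_apply i).comp continuous_fst).smul
      (hf.comp ((continuous_apply i).comp continuous_snd))
  let D : Set E := F '' ((Set.univ.pi fun _ => Set.Icc (0:ℝ) R) ×ˢ Set.univ)
  have hD : IsCompact D :=
    ((isCompact_univ_pi fun _ => isCompact_Icc).prod isCompact_univ).image hF
  have hU : IsOpen {x : E | L x < L y + 1} := isOpen_lt L.continuous continuous_const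
  have hy2 : y ∈ closure ({x : E | L x < L y + 1} ∩ coneHull (Set.range f)) :=
    hU.inter_closure ⟨by simp, hy⟩
  have hsub : {x : E | L x < L y + 1} ∩ coneHull (Set.range f) ⊆ D := by
    rintro x ⟨hx1, hx2⟩
    obtain ⟨c, v, hc, rfl⟩ := coneHull_caratheodory f x hx2
    refine ⟨(c, v), ⟨?_, Set.mem_univ _⟩, rfl⟩
    intro i _
    refine ⟨hc i, ?_⟩
    change c i ≤ (L y + 1) / δ
    rw [le_div_iff₀ hδ0]
    have h2 : L (∑ i, c i • f (v i)) = ∑ i, c i * L (f (v i)) := by simp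
    have h3 : c i * L (f (v i)) ≤ ∑ i, c i * L (f (v i)) :=
      Finset.single_le_sum (f := fun i => c i * L (f (v i)))
        (fun j _ => mul_nonneg (hc j) (hL _).le) (Finset.mem_univ i)
    have h4 : c i * δ ≤ c i * L (f (v i)) := mul_le_mul_of_nonneg_left (hδle _) (hc i)
    have h5 : L (∑ i, c i • f (v i)) < L y + 1 := hx1
    linarith
  have hyD : y ∈ D := closure_minimal hsub hD.isClosed hy2
  obtain ⟨⟨c, v⟩, ⟨hc, -⟩, rfl⟩ := hyD
  exact ⟨N, c, fun i => f (v i), fun i => (hc i (Set.mem_univ i)).1,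
    fun i => Set.mem_range_self _, rfl⟩

/-- For the pure inequality system with `X` finite-dimensional and `T` a compact
metric space, if `t ↦ g t xb` and `t ↦ dg t` are continuous and the EMFCQ holds at the feasible
point `xb`, then the NFMCQ holds: the convex conic hull of
`{(dg t, ⟨dg t, xb⟩ - g t xb) : t ∈ T}` is closed in `X* × ℝ`. -/
theorem statement5 {X T : Type*} [NormedAddCommGroup X] [NormedSpace ℝ X]
    [FiniteDimensional ℝ X] [MetricSpace T] [CompactSpace T]
    (g : T → X → ℝ) (dg : T → X →L[ℝ] ℝ) (xb : X)
    (hgd : ∀ t : T, HasFDerivAt (g t) (dg t) xb)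
    (hfeas : ∀ t : T, g t xb ≤ 0)
    (hc1 : Continuous fun t : T => g t xb)
    (hc2 : Continuous fun t : T => dg t)
    (hemfcq : ∃ xt : X, ∀ t : T, g t xb = 0 → dg t xt < 0) :
    IsClosed (coneHull (Set.range fun t : T => (dg t, dg t xb - g t xb))) := by
  rcases isEmpty_or_nonempty T with hT | hT
  · have : coneHull (Set.range fun t : T => (dg t, dg t xb - g t xb)) = {0} := by
      ext x
      constructor
      · rintro ⟨n, c, v, hc, hv, rfl⟩
        have : ∀ i : Fin n, False := fun i => by
          obtain ⟨t, -⟩ := hv i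
          exact hT.false t
        exact Finset.sum_eq_zero fun i _ => (this i).elim
      · rintro rfl
        exact ⟨0, Fin.elim0, Fin.elim0, fun i => i.elim0, fun i => i.elim0, by simp⟩
    rw [this]
    exact isClosed_singleton
  obtain ⟨xt, hxt⟩ := hemfcq
  have hcx : ∀ x : X, Continuous fun t : T => dg t x := fun x => hc2.clm_apply continuous_const
  obtain ⟨n, hn⟩ : ∃ n : ℕ, (Set.univ : Set T) ⊆ {t | dg t xt < n * (-g t xb)} := by
    refine isCompact_univ.elim_directed_cover (fun n : ℕ => {t | dg t xt < n * (-g t xb)})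
      (fun n => isOpen_lt (hcx xt) (continuous_const.mul hc1.neg)) ?_ ?_
    · intro t _
      rw [Set.mem_iUnion]
      rcases (hfeas t).eq_or_lt with h | h
      · exact ⟨0, by simpa using hxt t h⟩
      · obtain ⟨n, hn⟩ := exists_nat_gt (dg t xt / (-g t xb))
        exact ⟨n, (div_lt_iff₀ (by linarith)).1 hn⟩
    · refine directed_of_isDirected_le fun a b hab t ht => ?_
      have h1 : (a : ℝ) ≤ b := by exact_mod_cast hab
      exact lt_of_lt_of_le ht (mul_le_mul_of_nonneg_right h1 (by linarith [hfeas t]))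
  let ev : X → ((X →L[ℝ] ℝ) × ℝ) →L[ℝ] ℝ := fun x =>
    (ContinuousLinearMap.apply ℝ ℝ x).comp (ContinuousLinearMap.fst ℝ (X →L[ℝ] ℝ) ℝ)
  refine coneHull_closed _ (hc2.prodMk ((hcx xb).sub hc1))
    ((n : ℝ) • (ContinuousLinearMap.snd ℝ (X →L[ℝ] ℝ) ℝ - ev xb) - ev xt) fun t => ?_
  have h : dg t xt < n * (-g t xb) := hn (Set.mem_univ t)
  simp [ev]
  linarith
end

section
/- Let A : X → Y be a surjective continuous linear operator between real Banach spaces. Then the image A*(Y*) of the adjoint operator A* : Y* → X* is a weak* closed linear subspace of X*. -/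
open Filter Topology Set Pointwise

/-- If `A : X → Y` is a surjective continuous linear operator between Banach
spaces, then the image `A*(Y*)` of the adjoint operator is a weak* closed linear subspace of
`X*`. -/
theorem statement6 {X Y : Type*} [NormedAddCommGroup X] [NormedSpace ℝ X] [CompleteSpace X]
    [NormedAddCommGroup Y] [NormedSpace ℝ Y] [CompleteSpace Y]
    (A : X →L[ℝ] Y) (hsurj : Function.Surjective A) :
    (∃ S : Submodule ℝ (X →L[ℝ] ℝ), (S : Set (X →L[ℝ] ℝ)) = adjRange A) ∧
      IsWeakStarClosed (adjRange A) := by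
  have key : ∀ p : X →L[ℝ] ℝ, p ∈ adjRange A ↔ ∀ x, A x = 0 → p x = 0 := by
    intro p
    constructor
    · rintro ⟨q, rfl⟩ x hx
      simp [hx]
    · intro h
      obtain ⟨C, Cpos, hC⟩ := A.exists_preimage_norm_le hsurj
      choose s hs hsn using hC
      have h2 : ∀ x x', A x = A x' → p x = p x' := by
        intro x x' hx
        have := h (x - x') (by rw [map_sub, hx, sub_self])
        rw [map_sub] at this
        linarith
      let l : Y →ₗ[ℝ] ℝ :=
        { toFun := fun y => p (s y)
          map_add' := fun y z => by
            rw [← map_add]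
            exact h2 _ _ (by rw [map_add, hs, hs, hs])
          map_smul' := fun c y => by
            rw [RingHom.id_apply, ← map_smul]
            exact h2 _ _ (by rw [map_smul, hs, hs]) }
      refine ⟨l.mkContinuous (‖p‖ * C) ?_, ?_⟩
      · intro y
        calc ‖p (s y)‖ ≤ ‖p‖ * ‖s y‖ := p.le_opNorm _
          _ ≤ ‖p‖ * (C * ‖y‖) := by gcongr; exact hsn y
          _ = ‖p‖ * C * ‖y‖ := by ring
      · ext x
        exact h2 _ _ (hs _)
  refine ⟨⟨{ carrier := adjRange A, add_mem' := ?_, zero_mem' := ?_, smul_mem' := ?_ }, rfl⟩, ?_⟩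
  · intro a b ha hb
    rw [key] at ha hb ⊢
    intro x hx
    simp [ha x hx, hb x hx]
  · rw [key]
    intro x _
    rfl
  · intro c a ha
    rw [key] at ha ⊢
    intro x hx
    simp [ha x hx]
  · have heq : (toWD '' adjRange A : Set (WeakDual ℝ X)) =
        ⋂ x : X, ⋂ _ : A x = 0, {w : WeakDual ℝ X | w x = 0} := by
      ext w
      simp only [Set.mem_iInter, Set.mem_setOf_eq]
      constructor
      · rintro ⟨p, hp, rfl⟩
        exact (key p).1 hp
      · intro h
        exact ⟨WeakDual.toStrongDual w, (key _).2 h, rfl⟩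
    unfold IsWeakStarClosed
    rw [heq]
    exact isClosed_iInter fun x => isClosed_iInter fun _ =>
      isClosed_eq (WeakDual.eval_continuous x) continuous_const
end

section
/- Let x̄ ∈ Ω, suppose the PMFCQ holds at x̄, and assume that the family {g_t}_{t∈T} is uniformly Fréchet differentiable at x̄. Then the Fréchet normal cone to Ω at x̄ is computed by N̂(x̄; Ω) = ⋂_{ε>0} cl* cone{∇g_t(x̄) : t ∈ T_ε(x̄)} + ∇h(x̄)*(Y*). -/
open Filter Topology Set Pointwise

section Helpers

variable {X Y : Type*} [NormedAddCommGroup X] [NormedSpace ℝ X]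
  [NormedAddCommGroup Y] [NormedSpace ℝ Y]

theorem aux_cone_ineq {S : Set (X →L[ℝ] ℝ)} {q : X →L[ℝ] ℝ} {w : X}
    (hq : q ∈ wkClosure (coneHull S)) (hw : ∀ a ∈ S, a w ≤ 0) : q w ≤ 0 := by
  have hcl : IsClosed {r : WeakDual ℝ X | r w ≤ 0} :=
    isClosed_le (WeakDual.eval_continuous w) continuous_const
  have hsub : toWD '' (coneHull S) ⊆ {r : WeakDual ℝ X | r w ≤ 0} := by
    rintro _ ⟨r, ⟨n, c, v, hc, hv, rfl⟩, rfl⟩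
    change (∑ i, c i • v i) w ≤ 0
    rw [ContinuousLinearMap.sum_apply]
    refine Finset.sum_nonpos fun i _ => ?_
    exact mul_nonpos_of_nonneg_of_nonpos (hc i) (hw _ (hv i))
  exact closure_minimal hsub hcl hq

theorem aux_cone_norm {S : Set (X →L[ℝ] ℝ)} {r : X →L[ℝ] ℝ} {w : X} {M δ : ℝ} (hδ : 0 < δ)
    (hM : 0 ≤ M)
    (hr : r ∈ coneHull S) (hw : ∀ a ∈ S, a w ≤ -δ) (hn : ∀ a ∈ S, ‖a‖ ≤ M) :
    ‖r‖ ≤ M / δ * (-r w) := by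
  obtain ⟨n, c, v, hc, hv, rfl⟩ := hr
  rw [ContinuousLinearMap.sum_apply, ← Finset.sum_neg_distrib, Finset.mul_sum]
  refine (norm_sum_le _ _).trans (Finset.sum_le_sum fun i _ => ?_)
  rw [norm_smul, Real.norm_of_nonneg (hc i)]
  change c i * ‖v i‖ ≤ M / δ * -(c i * (v i) w)
  have h1 := hw _ (hv i)
  have h2 := hn _ (hv i)
  have h3 : M ≤ M / δ * (-(v i) w) := by
    calc M = M / δ * δ := by field_simp
      _ ≤ _ := mul_le_mul_of_nonneg_left (by linarith) (by positivity)
  calc c i * ‖v i‖ ≤ c i * (M / δ * (-(v i) w)) :=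
        mul_le_mul_of_nonneg_left (h2.trans h3) (hc i)
    _ = _ := by ring

theorem aux_cone_zero {E : Type*} [AddCommMonoid E] [Module ℝ E] (S : Set E) :
    (0 : E) ∈ coneHull S :=
  ⟨0, Fin.elim0, Fin.elim0, fun i => i.elim0, fun i => i.elim0, by simp⟩

theorem aux_cone_single {E : Type*} [AddCommMonoid E] [Module ℝ E] {S : Set E} {a : E}
    (ha : a ∈ S) : a ∈ coneHull S :=
  ⟨1, fun _ => 1, fun _ => a, fun _ => zero_le_one, fun _ => ha, by simp⟩

theorem aux_cone_smul {E : Type*} [AddCommMonoid E] [Module ℝ E] {S : Set E} {a : E} {k : ℝ}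
    (hk : 0 ≤ k) (ha : a ∈ coneHull S) : k • a ∈ coneHull S := by
  obtain ⟨n, c, v, hc, hv, rfl⟩ := ha
  exact ⟨n, fun i => k * c i, v, fun i => mul_nonneg hk (hc i), hv, by
    simp [Finset.smul_sum, mul_smul]⟩

theorem aux_cone_add {E : Type*} [AddCommMonoid E] [Module ℝ E] {S : Set E} {a b : E}
    (ha : a ∈ coneHull S) (hb : b ∈ coneHull S) : a + b ∈ coneHull S := by
  obtain ⟨n, c, v, hc, hv, rfl⟩ := ha
  obtain ⟨m, d, w, hd, hw, rfl⟩ := hb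
  refine ⟨n + m, Fin.append c d, Fin.append v w, ?_, ?_, ?_⟩
  · intro i
    refine Fin.addCases (fun i => ?_) (fun i => ?_) i
    · simpa using hc i
    · simpa using hd i
  · intro i
    refine Fin.addCases (fun i => ?_) (fun i => ?_) i
    · simpa using hv i
    · simpa using hw i
  · simp [Fin.sum_univ_add]

theorem aux_cone_mono {E : Type*} [AddCommMonoid E] [Module ℝ E] {S S' : Set E} (h : S ⊆ S') :
    coneHull S ⊆ coneHull S' := by
  rintro _ ⟨n, c, v, hc, hv, rfl⟩
  exact ⟨n, c, v, hc, fun i => h (hv i), rfl⟩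

theorem aux_sep {S : Set (X →L[ℝ] ℝ)} (A : X →L[ℝ] Y) {p : X →L[ℝ] ℝ}
    (hp : ∀ x : X, (∀ a ∈ S, a x ≤ 0) → A x = 0 → p x ≤ 0) :
    toWD p ∈ closure (toWD '' (coneHull S + adjRange A)) := by
  by_contra hcon
  have hconv : Convex ℝ (toWD '' (coneHull S + adjRange A)) := by
    rintro _ ⟨_, ⟨r, hr, _, ⟨q, rfl⟩, rfl⟩, rfl⟩ _ ⟨_, ⟨r', hr', _, ⟨q', rfl⟩, rfl⟩, rfl⟩ a b ha hb _
    refine ⟨_, ⟨a • r + b • r', aux_cone_add (aux_cone_smul ha hr) (aux_cone_smul hb hr'), _,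
      ⟨a • q + b • q', rfl⟩, rfl⟩, ?_⟩
    change _ = a • (r + q.comp A) + b • (r' + q'.comp A)
    change a • r + b • r' + (a • q + b • q').comp A = _
    ext x
    simp
    ring
  haveI : LocallyConvexSpace ℝ (WeakDual ℝ X) :=
    inferInstanceAs (LocallyConvexSpace ℝ (WeakBilin (topDualPairing ℝ X)))
  obtain ⟨f, u, hfu, hup⟩ := geometric_hahn_banach_closed_point hconv.closure isClosed_closure hcon
  obtain ⟨x, hx⟩ := LinearMap.dualEmbedding_surjective (topDualPairing ℝ X) f
  have hfx : ∀ r : X →L[ℝ] ℝ, f (toWD r) = r x := by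
    intro r
    rw [← hx]
    rfl
  have hC : ∀ r ∈ coneHull S, ∀ q : Y →L[ℝ] ℝ, r x + q (A x) < u := by
    intro r hr q
    have := hfu (toWD (r + q.comp A)) (subset_closure ⟨_, ⟨r, hr, _, ⟨q, rfl⟩, rfl⟩, rfl⟩)
    rw [hfx] at this
    simpa using this
  rw [hfx] at hup
  have hu : 0 < u := by simpa using hC 0 (aux_cone_zero S) 0
  have h1 : ∀ a ∈ S, a x ≤ 0 := by
    intro a ha
    by_contra! hax
    have := hC ((u / a x) • a) (aux_cone_smul (by positivity) (aux_cone_single ha)) 0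
    simp [hax.ne'] at this
  have h2 : A x = 0 := by
    refine NormedSpace.eq_zero_of_forall_dual_eq_zero ℝ fun q => ?_
    by_contra hq
    have := hC 0 (aux_cone_zero S) ((u / q (A x)) • q)
    simp [hq] at this
  linarith [hp x h1 h2]

theorem aux_adj [CompleteSpace X] [CompleteSpace Y] {A : X →L[ℝ] Y}
    (hA : Function.Surjective A) (l : X →L[ℝ] ℝ) :
    l ∈ adjRange A ↔ ∀ x, A x = 0 → l x = 0 := by
  constructor
  · rintro ⟨q, rfl⟩ x hx
    simp [hx]
  · intro hl
    obtain ⟨B, hB⟩ := A.exists_nonlinearRightInverse_of_surjective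
      (LinearMap.range_eq_top.2 hA)
    have hAB : ∀ y, A (B y) = y := B.right_inv
    have key : ∀ x x', A x = A x' → l x = l x' := by
      intro x x' h
      have := hl (x - x') (by simp [h])
      rw [map_sub] at this
      linarith
    let q : Y →ₗ[ℝ] ℝ :=
      { toFun := fun y => l (B y)
        map_add' := fun y z => by
          rw [← map_add]
          exact key _ _ (by simp [hAB])
        map_smul' := fun c y => by
          rw [RingHom.id_apply, ← map_smul]
          exact key _ _ (by simp [hAB]) }
    refine ⟨q.mkContinuous (‖l‖ * B.nnnorm) fun y => ?_, ?_⟩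
    · calc ‖l (B y)‖ ≤ ‖l‖ * ‖B y‖ := l.le_opNorm _
        _ ≤ ‖l‖ * (B.nnnorm * ‖y‖) := by gcongr; exact B.bound y
        _ = _ := by ring
    · ext x
      change l (B (A x)) = l x
      exact key _ _ (hAB _)

theorem aux_ev (c : ℝ) {e : ℝ} (he : 0 < e) : ∀ᶠ s in 𝓝[>] (0:ℝ), c * s < e := by
  have : Tendsto (fun s : ℝ => c * s) (𝓝[>] 0) (𝓝 0) := by
    have h : Tendsto (fun s : ℝ => c * s) (𝓝 0) (𝓝 (c * 0)) :=
      (continuous_const.mul continuous_id).tendsto 0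
    rw [mul_zero] at h
    exact h.mono_left nhdsWithin_le_nhds
  exact this.eventually (gt_mem_nhds he)

theorem aux_lyusternik [CompleteSpace X] [CompleteSpace Y] {h : X → Y} {dh : X →L[ℝ] Y} {xb : X}
    (hhd : HasStrictFDerivAt h dh xb) (hsurj : Function.Surjective dh) (h0 : h xb = 0)
    {v : X} (hv : dh v = 0) {γ : ℝ} (hγ : 0 < γ) :
    ∀ᶠ s in 𝓝[>] (0:ℝ), ∃ u, h u = 0 ∧ ‖u - (xb + s • v)‖ ≤ γ * s := by
  obtain ⟨B, hB⟩ := dh.exists_nonlinearRightInverse_of_surjective (LinearMap.range_eq_top.2 hsurj)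
  set c : NNReal := B.nnnorm⁻¹ / 2 with hc
  have cpos : 0 < c := by simp [hc, hB]
  obtain ⟨U, hU, hUa⟩ := hhd.approximates_deriv_on_nhds (c := c) (Or.inr cpos)
  obtain ⟨r, hr, hrU⟩ := Metric.mem_nhds_iff.1 hU
  have hcr : (0:ℝ) < c := cpos
  have hc' : 0 < (c:ℝ) * γ / (‖v‖ + 1) := by positivity
  have hlo := (hhd.hasFDerivAt.isLittleO.def hc')
  have htend : Tendsto (fun s : ℝ => xb + s • v) (𝓝[>] 0) (𝓝 xb) := by
    have hh : Tendsto (fun s : ℝ => xb + s • v) (𝓝 0) (𝓝 (xb + (0:ℝ) • v)) :=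
      (continuous_const.add (continuous_id.smul continuous_const)).tendsto 0
    rw [zero_smul, add_zero] at hh
    exact hh.mono_left nhdsWithin_le_nhds
  filter_upwards [htend.eventually hlo, aux_ev (‖v‖ + γ) hr, self_mem_nhdsWithin] with s hs1 hs2 hs0
  replace hs0 : 0 < s := hs0
  have hsv : ‖s • v‖ = s * ‖v‖ := by rw [norm_smul, Real.norm_of_nonneg hs0.le]
  have hb : ‖h (xb + s • v)‖ ≤ c * (γ * s) := by
    rw [h0, add_sub_cancel_left, map_smul, hv, smul_zero, sub_zero, sub_zero, hsv] at hs1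
    refine hs1.trans ?_
    calc (c:ℝ) * γ / (‖v‖ + 1) * (s * ‖v‖) ≤ (c:ℝ) * γ / (‖v‖ + 1) * (s * (‖v‖ + 1)) := by
          gcongr; linarith
      _ = _ := by field_simp
  have hsub : Metric.closedBall (xb + s • v) (γ * s) ⊆ U := by
    intro z hz
    apply hrU
    rw [Metric.mem_closedBall, dist_eq_norm] at hz
    rw [Metric.mem_ball, dist_eq_norm]
    calc ‖z - xb‖ = ‖(z - (xb + s • v)) + s • v‖ := by congr 1; abel
      _ ≤ γ * s + s * ‖v‖ := (norm_add_le _ _).trans (by rw [hsv]; linarith)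
      _ < r := by linarith
  have hso := hUa.surjOn_closedBall_of_nonlinearRightInverse B (by positivity : 0 ≤ γ * s) hsub
  have hmem : (0:Y) ∈ Metric.closedBall (h (xb + s • v)) (((B.nnnorm : ℝ)⁻¹ - c) * (γ * s)) := by
    rw [Metric.mem_closedBall, dist_eq_norm, zero_sub, norm_neg]
    refine hb.trans (le_of_eq ?_)
    rw [hc]
    push_cast
    ring
  obtain ⟨u, hu, hu0⟩ := hso hmem
  exact ⟨u, hu0, by simpa [dist_eq_norm] using hu⟩

theorem aux_primal {T : Type*} [CompleteSpace X] [CompleteSpace Y]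
    (g : T → X → ℝ) (dg : T → X →L[ℝ] ℝ) (h : X → Y) (dh : X →L[ℝ] Y) (xb : X)
    (hhd : HasStrictFDerivAt h dh xb)
    {M : ℝ} (hM0 : 0 ≤ M) (hM : ∀ t : T, ‖dg t‖ ≤ M)
    (hxb : xb ∈ {x : X | h x = 0 ∧ ∀ t : T, g t x ≤ 0})
    (hsurj : Function.Surjective dh)
    {xt : X} (hxt : dh xt = 0) {ε δ : ℝ} (hε : 0 < ε) (hδ : 0 < δ)
    (hcq : ∀ t : T, -ε ≤ g t xb → dg t xt ≤ -δ)
    (hunif : UnifFrechetDiffAt g dg xb) {p : X →L[ℝ] ℝ}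
    (hp : p ∈ frechetNormal {x : X | h x = 0 ∧ ∀ t : T, g t x ≤ 0} xb)
    {x : X} (hx : ∀ t : T, -ε ≤ g t xb → dg t x ≤ 0) (hdx : dh x = 0) : p x ≤ 0 := by
  by_contra! hpx
  obtain ⟨η, hη, hP⟩ : ∃ η > (0:ℝ), 0 < p (x + η • xt) := by
    have := (aux_ev (-(p xt)) hpx).and self_mem_nhdsWithin
    obtain ⟨η, h1, h2⟩ := this.exists
    refine ⟨η, h2, ?_⟩
    rw [map_add, map_smul, smul_eq_mul]
    linarith
  set v := x + η • xt with hv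
  have hdv : dh v = 0 := by simp [hv, hdx, hxt]
  set P := p v
  set κ := η * δ with hκ
  have hκ0 : 0 < κ := by positivity
  have hgv : ∀ t : T, -ε ≤ g t xb → dg t v ≤ -κ := by
    intro t ht
    have h1 := hx t ht
    have h2 := mul_le_mul_of_nonneg_left (hcq t ht) hη.le
    rw [hv, map_add, map_smul, smul_eq_mul]
    linarith
  obtain ⟨γ, hγ, hγ1, hγM, hγp⟩ : ∃ γ > (0:ℝ), 1 * γ < 1 ∧ M * γ < κ / 2 ∧ ‖p‖ * γ < P / 4 := by
    obtain ⟨γ, h1, h2, h3, h4⟩ := ((aux_ev 1 one_pos).and ((aux_ev M (half_pos hκ0)).and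
      ((aux_ev ‖p‖ (by positivity : 0 < P / 4)).and self_mem_nhdsWithin))).exists
    exact ⟨γ, h4, h1, h2, h3⟩
  set B := ‖v‖ + 1 with hB
  have hB0 : 0 < B := by positivity
  obtain ⟨η1, hη1, hU⟩ := hunif (κ / (2 * B)) (by positivity)
  obtain ⟨δ', hδ', hF⟩ := hp (P / (4 * B)) (by positivity)
  obtain ⟨s, ⟨u, hu0, hu⟩, hs1, hs2, hs3, hs0⟩ :=
    ((aux_lyusternik hhd hsurj hxb.1 hdv hγ).and ((aux_ev B hη1).and ((aux_ev B hδ').and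
      ((aux_ev (M * B + κ / 2) hε).and self_mem_nhdsWithin)))).exists
  replace hs0 : 0 < s := hs0
  have hdec : u - xb = s • v + (u - (xb + s • v)) := by abel
  have huB : ‖u - xb‖ ≤ B * s := by
    rw [hdec]
    refine (norm_add_le _ _).trans ?_
    rw [norm_smul, Real.norm_of_nonneg hs0.le, hB]
    nlinarith
  have happ : ∀ (l : X →L[ℝ] ℝ), |l (u - xb) - s * l v| ≤ ‖l‖ * (γ * s) := by
    intro l
    rw [hdec, map_add, map_smul, smul_eq_mul, add_sub_cancel_left]
    exact (l.le_opNorm _).trans (by gcongr)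
  have huΩ : ∀ t : T, g t u ≤ 0 := by
    intro t
    have h1 := (abs_le.1 (hU t u (by linarith))).2
    have h2 : κ / (2 * B) * ‖u - xb‖ ≤ κ / 2 * s := by
      calc κ / (2 * B) * ‖u - xb‖ ≤ κ / (2 * B) * (B * s) := by gcongr
        _ = _ := by field_simp
    by_cases ht : -ε ≤ g t xb
    · have h3 := (abs_le.1 (happ (dg t))).2
      have h4 : ‖dg t‖ * (γ * s) ≤ κ / 2 * s := by
        calc ‖dg t‖ * (γ * s) ≤ M * (γ * s) := by gcongr; exact hM t
          _ = (M * γ) * s := by ring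
          _ ≤ _ := by gcongr
      have h5 := mul_le_mul_of_nonneg_left (hgv t ht) hs0.le
      have h6 := hxb.2 t
      linarith
    · have h3 : dg t (u - xb) ≤ M * (B * s) :=
        (le_abs_self _).trans (((dg t).le_opNorm _).trans (by gcongr; exact hM t))
      push Not at ht
      linarith
  have h1 := hF u ⟨hu0, huΩ⟩ (by linarith)
  have h2 : (0 + P / (4 * B)) * ‖u - xb‖ ≤ P / 4 * s := by
    rw [zero_add]
    calc P / (4 * B) * ‖u - xb‖ ≤ P / (4 * B) * (B * s) := by gcongr
      _ = _ := by field_simp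
  have h3 := (abs_le.1 (happ p)).1
  have h4 : ‖p‖ * (γ * s) ≤ P / 4 * s := by
    rw [← mul_assoc]
    gcongr
  have h5 : 0 < P * s := by positivity
  change -(‖p‖ * (γ * s)) ≤ p (u - xb) - s * P at h3
  linarith

theorem aux_decomp [CompleteSpace X] [CompleteSpace Y] {S : Set (X →L[ℝ] ℝ)} {A : X →L[ℝ] Y}
    (hA : Function.Surjective A) {p : X →L[ℝ] ℝ} {xt : X} (hxt : A xt = 0) {M δ : ℝ}
    (hM : 0 ≤ M) (hδ : 0 < δ) (hw : ∀ a ∈ S, a xt ≤ -δ) (hn : ∀ a ∈ S, ‖a‖ ≤ M)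
    (hp : toWD p ∈ closure (toWD '' (coneHull S + adjRange A))) :
    ∃ q : WeakDual ℝ X, q ∈ closure (toWD '' coneHull S) ∧
      q ∈ WeakDual.toStrongDual ⁻¹' Metric.closedBall (0 : StrongDual ℝ X) (M / δ * (1 - p xt)) ∧
      ∀ x, A x = 0 → q x = p x := by
  set R := M / δ * (1 - p xt)
  set K : Set (WeakDual ℝ X) := closure (toWD '' coneHull S) ∩
    WeakDual.toStrongDual ⁻¹' Metric.closedBall (0 : StrongDual ℝ X) R with hK
  have hKc : IsCompact K := (WeakDual.isCompact_closedBall 0 R).inter_left isClosed_closure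
  set L : Set (WeakDual ℝ X) := {l | ∀ x, A x = 0 → l x = 0} with hL
  have hLc : IsClosed L := by
    have : L = ⋂ x : X, ⋂ _ : A x = 0, {l : WeakDual ℝ X | l x = 0} := by
      ext l; simp [hL]
    rw [this]
    exact isClosed_iInter fun x => isClosed_iInter fun _ =>
      isClosed_eq (WeakDual.eval_continuous x) continuous_const
  have hKL : IsClosed (K + L) := hLc.add_left_of_isCompact hKc
  have hUo : IsOpen {r : WeakDual ℝ X | p xt - 1 < r xt} :=
    isOpen_lt continuous_const (WeakDual.eval_continuous xt)
  have hpU : toWD p ∈ {r : WeakDual ℝ X | p xt - 1 < r xt} := by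
    change p xt - 1 < p xt
    linarith
  have hmem : toWD p ∈ K + L := by
    refine closure_minimal ?_ hKL (hUo.inter_closure ⟨hpU, hp⟩)
    rintro _ ⟨hr, ⟨_, ⟨r, hrc, l, hl, rfl⟩, rfl⟩⟩
    have hl' := (aux_adj hA l).1 hl
    refine ⟨toWD r, ⟨subset_closure ⟨r, hrc, rfl⟩, ?_⟩, toWD l, hl', rfl⟩
    change r ∈ Metric.closedBall (0 : StrongDual ℝ X) R
    rw [mem_closedBall_zero_iff]
    refine (aux_cone_norm hδ hM hrc hw hn).trans ?_
    have : p xt - 1 < r xt + l xt := hr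
    rw [hl' xt hxt] at this
    exact mul_le_mul_of_nonneg_left (by linarith) (by positivity)
  obtain ⟨q, hq, l, hl, hql⟩ := hmem
  refine ⟨q, hq.1, hq.2, fun x hx => ?_⟩
  have h1 : q x + l x = p x := DFunLike.congr_fun hql x
  rw [hl x hx] at h1
  linarith

end Helpers

/-- Under the standing assumptions, the PMFCQ at `xb`, and the uniform Fréchet
differentiability of `{g t}` at `xb`, the Fréchet normal cone to the feasible set
`Ω = {x | h x = 0, g t x ≤ 0 ∀ t}` at `xb` equals
`⋂_{ε>0} cl* cone{dg t : t ∈ T_ε(xb)} + ∇h(xb)*(Y*)`. -/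
theorem statement7 {X Y T : Type*} [NormedAddCommGroup X] [NormedSpace ℝ X] [CompleteSpace X]
    [NormedAddCommGroup Y] [NormedSpace ℝ Y] [CompleteSpace Y]
    (g : T → X → ℝ) (dg : T → X →L[ℝ] ℝ) (h : X → Y) (dh : X →L[ℝ] Y) (xb : X)
    (hgd : ∀ t : T, HasFDerivAt (g t) (dg t) xb)
    (hhd : HasStrictFDerivAt h dh xb)
    (hbd : ∃ M : ℝ, ∀ t : T, ‖dg t‖ ≤ M)
    (hxb : xb ∈ {x : X | h x = 0 ∧ ∀ t : T, g t x ≤ 0})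
    (hsurj : Function.Surjective dh)
    (hpmfcq : ∃ xt : X, dh xt = 0 ∧ PMFCQat g dg xb xt)
    (hunif : UnifFrechetDiffAt g dg xb) :
    frechetNormal {x : X | h x = 0 ∧ ∀ t : T, g t x ≤ 0} xb =
      (⋂ ε > (0:ℝ), wkClosure (coneHull (dg '' {t : T | -ε ≤ g t xb}))) + adjRange dh := by
  obtain ⟨M', hM'⟩ := hbd
  obtain ⟨xt, hxt, ε0, hε0, δ, hδ, hcq⟩ := hpmfcq
  have hM0 : 0 ≤ max M' 0 := le_max_right _ _
  have hM : ∀ t, ‖dg t‖ ≤ max M' 0 := fun t => (hM' t).trans (le_max_left _ _)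
  generalize max M' 0 = M at hM0 hM
  apply Set.Subset.antisymm
  · intro p hp
    let I := {ε : ℝ // 0 < ε ∧ ε ≤ ε0}
    let R := M / δ * (1 - p xt)
    let Z : I → Set (WeakDual ℝ X) := fun ε =>
      closure (toWD '' coneHull (dg '' {t : T | -ε.1 ≤ g t xb})) ∩
      ((WeakDual.toStrongDual ⁻¹' Metric.closedBall (0 : StrongDual ℝ X) R) ∩
        {q : WeakDual ℝ X | ∀ x, dh x = 0 → q x = p x})
    have hLc : IsClosed {q : WeakDual ℝ X | ∀ x, dh x = 0 → q x = p x} := by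
      have : {q : WeakDual ℝ X | ∀ x, dh x = 0 → q x = p x} =
          ⋂ x : X, ⋂ _ : dh x = 0, {l : WeakDual ℝ X | l x = p x} := by
        ext l; simp
      rw [this]
      exact isClosed_iInter fun x => isClosed_iInter fun _ =>
        isClosed_eq (WeakDual.eval_continuous x) continuous_const
    have hZc : ∀ i, IsCompact (Z i) := fun i =>
      ((WeakDual.isCompact_closedBall 0 R).inter_right hLc).inter_left isClosed_closure
    have hZcl : ∀ i, IsClosed (Z i) := fun i => (hZc i).isClosed
    have hZm : ∀ i j : I, i.1 ≤ j.1 → Z i ⊆ Z j := by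
      intro i j hij
      refine Set.inter_subset_inter_left _ (closure_mono (Set.image_mono (aux_cone_mono
        (Set.image_mono ?_))))
      intro t ht
      have : -i.1 ≤ g t xb := ht
      change -j.1 ≤ g t xb
      linarith
    have hZd : Directed (· ⊇ ·) Z := by
      intro i j
      rcases le_total i.1 j.1 with hij | hij
      · exact ⟨i, subset_rfl, hZm i j hij⟩
      · exact ⟨j, hZm j i hij, subset_rfl⟩
    have hZn : ∀ i, (Z i).Nonempty := by
      rintro ⟨ε, hε, hεε⟩
      have hcq' : ∀ t : T, -ε ≤ g t xb → dg t xt ≤ -δ := fun t ht => hcq t (by linarith)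
      have hcl := aux_sep (S := dg '' {t : T | -ε ≤ g t xb}) dh (p := p) (by
        intro x hx hdx
        exact aux_primal g dg h dh xb hhd hM0 hM hxb hsurj hxt hε hδ hcq' hunif hp
          (fun t ht => hx _ ⟨t, ht, rfl⟩) hdx)
      obtain ⟨q, h1, h2, h3⟩ := aux_decomp hsurj hxt hM0 hδ
        (by rintro _ ⟨t, ht, rfl⟩; exact hcq' t ht) (by rintro _ ⟨t, ht, rfl⟩; exact hM t) hcl
      exact ⟨q, h1, h2, h3⟩
    haveI : Nonempty I := ⟨⟨ε0, hε0, le_rfl⟩⟩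
    obtain ⟨q, hq⟩ := IsCompact.nonempty_iInter_of_directed_nonempty_isCompact_isClosed
      Z hZd hZn hZc hZcl
    rw [Set.mem_iInter] at hq
    let q' : X →L[ℝ] ℝ := WeakDual.toStrongDual q
    refine ⟨q', ?_, p - q', ?_, ?_⟩
    · simp only [Set.mem_iInter]
      intro ε hε
      have h1 := (hq ⟨min ε ε0, lt_min hε hε0, min_le_right _ _⟩).1
      change q ∈ _
      refine closure_mono (Set.image_mono (aux_cone_mono (Set.image_mono ?_))) h1
      intro t ht
      have h2 : -(min ε ε0) ≤ g t xb := ht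
      change -ε ≤ g t xb
      have := min_le_left ε ε0
      linarith
    · refine (aux_adj hsurj _).2 fun x hx => ?_
      have : q' x = p x := (hq ⟨ε0, hε0, le_rfl⟩).2.2 x hx
      rw [ContinuousLinearMap.sub_apply, this, sub_self]
    · exact add_sub_cancel q' p
  · rintro _ ⟨q, hq, _, ⟨y, rfl⟩, rfl⟩
    simp only [Set.mem_iInter] at hq
    intro γ hγ
    -- the equality part
    have hy0 : 0 < γ / (2 * (‖y‖ + 1)) := by positivity
    obtain ⟨δ1, hδ1, hh1⟩ := Metric.eventually_nhds_iff.1 (hhd.hasFDerivAt.isLittleO.def hy0)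
    -- the inequality part
    set σ := γ * δ / (2 * (|q xt| + 1)) with hσ
    have hσ0 : 0 < σ := by positivity
    obtain ⟨δ2, hδ2, hU⟩ := hunif σ hσ0
    refine ⟨min δ1 δ2, lt_min hδ1 hδ2, ?_⟩
    rintro u ⟨hu0, hug⟩ hud
    have hy : y (dh (u - xb)) ≤ γ / 2 * ‖u - xb‖ := by
      have h1 := hh1 (y := u) (by rw [dist_eq_norm]; exact hud.trans_le (min_le_left _ _))
      rw [hu0, hxb.1, sub_zero, zero_sub, norm_neg] at h1
      calc y (dh (u - xb)) ≤ ‖y‖ * ‖dh (u - xb)‖ := (le_abs_self _).trans (y.le_opNorm _)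
        _ ≤ (‖y‖ + 1) * (γ / (2 * (‖y‖ + 1)) * ‖u - xb‖) := by
            gcongr
            linarith
        _ = _ := by field_simp
    have hqe : ∀ ε > 0, ε ≤ ε0 → q (u - xb) ≤ (ε + σ * ‖u - xb‖) / δ * |q xt| := by
      intro ε hε hεε
      set k := (ε + σ * ‖u - xb‖) / δ with hk
      have hk0 : 0 ≤ k := by positivity
      have h1 := aux_cone_ineq (w := (u - xb) + k • xt) (hq ε hε) (by
        rintro _ ⟨t, ht, rfl⟩
        have ht' : -ε ≤ g t xb := ht
        have h2 := (abs_le.1 (hU t u (hud.le.trans (min_le_right _ _)))).1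
        have h3 := mul_le_mul_of_nonneg_left (hcq t (by linarith)) hk0
        have h4 : k * δ = ε + σ * ‖u - xb‖ := by rw [hk]; field_simp
        have h5 := hug t
        rw [map_add, map_smul, smul_eq_mul]
        linarith)
      rw [map_add, map_smul, smul_eq_mul] at h1
      have h2 := mul_le_mul_of_nonneg_left (neg_abs_le (q xt)) hk0
      linarith
    have hq' : q (u - xb) ≤ γ / 2 * ‖u - xb‖ := by
      have h1 : q (u - xb) ≤ (σ * ‖u - xb‖) / δ * |q xt| := by
        refine le_of_forall_pos_lt_add fun e he => ?_
        obtain ⟨ε, h1, h2, h3⟩ := ((aux_ev (|q xt| / δ) he).and ((aux_ev 1 hε0).and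
          self_mem_nhdsWithin)).exists
        have h4 := hqe ε h3 (by linarith)
        have h5 : (ε + σ * ‖u - xb‖) / δ * |q xt| =
          (σ * ‖u - xb‖) / δ * |q xt| + |q xt| / δ * ε := by ring
        linarith
      refine h1.trans ?_
      calc (σ * ‖u - xb‖) / δ * |q xt| ≤ (σ * ‖u - xb‖) / δ * (|q xt| + 1) := by
            gcongr; linarith
        _ = _ := by rw [hσ]; field_simp
    change q (u - xb) + y (dh (u - xb)) ≤ _
    linarith
end

section
/- Assume: (a) each g_t, t ∈ T, is Fréchet differentiable at x̄ ∈ Ω with ‖∇g_t(x̄)‖ > 0 for all t, and h is strictly differentiable at x̄; (b) r̃(η) := sup_{t∈T} sup_{x,x′∈B_η(x̄), x≠x′} |g_t(x) − g_t(x′) − ⟨∇g_t(x̄), x − x′⟩| / (‖∇g_t(x̄)‖·‖x − x′‖) → 0 as η ↓ 0; (c) ∇h(x̄) : X → Y is surjective, and for some ε > 0 there exist x̃ ∈ X and σ > 0 with ∇h(x̄)x̃ = 0 and ⟨∇g_t(x̄), x̃ + x⟩ ≤ 0 for all ‖x‖ ≤ σ and all t ∈ T̃_ε(x̄) := {t ∈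 T : g_t(x̄) ≥ −ε‖∇g_t(x̄)‖}. Then N(x̄; Ω) = ⋂_{ε>0} cl* cone{∇g_t(x̄) : t ∈ T̃_ε(x̄)} + ∇h(x̄)*(Y*). -/
open Filter Topology Set Pointwise

theorem s9_coneHull_add {E : Type*} [AddCommMonoid E] [Module ℝ E] {S : Set E} {x y : E}
    (hx : x ∈ coneHull S) (hy : y ∈ coneHull S) : x + y ∈ coneHull S := by
  obtain ⟨n, c, v, hc, hv, rfl⟩ := hx
  obtain ⟨m, d, w, hd, hw, rfl⟩ := hy
  refine ⟨n + m, Fin.append c d, Fin.append v w, ?_, ?_, ?_⟩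
  · intro i
    refine Fin.addCases (fun j => ?_) (fun j => ?_) i
    · simpa using hc j
    · simpa using hd j
  · intro i
    refine Fin.addCases (fun j => ?_) (fun j => ?_) i
    · simpa using hv j
    · simpa using hw j
  · simp [Fin.sum_univ_add]

theorem s9_coneHull_smul {E : Type*} [AddCommMonoid E] [Module ℝ E] {S : Set E} {x : E} {r : ℝ}
    (hr : 0 ≤ r) (hx : x ∈ coneHull S) : r • x ∈ coneHull S := by
  obtain ⟨n, c, v, hc, hv, rfl⟩ := hx
  refine ⟨n, fun i => r * c i, v, fun i => mul_nonneg hr (hc i), hv, ?_⟩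
  simp [Finset.smul_sum, mul_smul]

theorem s9_mem_coneHull {E : Type*} [AddCommMonoid E] [Module ℝ E] {S : Set E} {x : E}
    (hx : x ∈ S) : x ∈ coneHull S :=
  ⟨1, fun _ => 1, fun _ => x, fun _ => zero_le_one, fun _ => hx, by simp⟩

theorem s9_zero_mem_coneHull {E : Type*} [AddCommMonoid E] [Module ℝ E] {S : Set E} :
    (0 : E) ∈ coneHull S :=
  ⟨0, fun _ => 1, fun _ => 0, fun _ => zero_le_one, fun i => i.elim0, by simp⟩

/-- Bipolar theorem. -/
theorem s9_bipolar {X : Type*} [NormedAddCommGroup X] [NormedSpace ℝ X]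
    (S : Set (X →L[ℝ] ℝ)) (a : X →L[ℝ] ℝ)
    (ha : ∀ v : X, (∀ p ∈ S, p v ≤ 0) → a v ≤ 0) : a ∈ wkClosure (coneHull S) := by
  by_contra hna
  have hconv : Convex ℝ (toWD '' coneHull S) := by
    rintro _ ⟨x, hx, rfl⟩ _ ⟨y, hy, rfl⟩ r s hr hs _
    exact ⟨r • x + s • y, s9_coneHull_add (s9_coneHull_smul hr hx) (s9_coneHull_smul hs hy), rfl⟩
  have : LocallyConvexSpace ℝ (WeakDual ℝ X) :=
    inferInstanceAs (LocallyConvexSpace ℝ (WeakBilin (topDualPairing ℝ X)))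
  obtain ⟨f, u, hf, hu⟩ := geometric_hahn_banach_closed_point (E := WeakDual ℝ X)
    hconv.closure isClosed_closure hna
  obtain ⟨v, hv⟩ := LinearMap.dualEmbedding_surjective (topDualPairing ℝ X) f
  have hfv : ∀ p : X →L[ℝ] ℝ, f (toWD p) = p v := by
    intro p
    rw [← hv]; rfl
  have h1 : ∀ p ∈ coneHull S, p v < u := fun p hp => by
    rw [← hfv]; exact hf _ (subset_closure ⟨p, hp, rfl⟩)
  have hu0 : 0 < u := by simpa using h1 0 s9_zero_mem_coneHull
  have h2 : ∀ p ∈ S, p v ≤ 0 := by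
    intro p hp
    by_contra hlt
    push Not at hlt
    have := h1 ((u / p v) • p) (s9_coneHull_smul (by positivity) (s9_mem_coneHull hp))
    simp [div_mul_cancel₀ _ hlt.ne'] at this
  have := ha v h2
  have hu' : u < a v := by
    rw [← hfv]
    exact hu
  linarith

/-- Easy half of the bipolar theorem. -/
theorem s9_bipolar_easy {X : Type*} [NormedAddCommGroup X] [NormedSpace ℝ X]
    (S : Set (X →L[ℝ] ℝ)) (a : X →L[ℝ] ℝ) (ha : a ∈ wkClosure (coneHull S))
    (v : X) (hv : ∀ p ∈ S, p v ≤ 0) : a v ≤ 0 := by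
  have hcl : IsClosed {p : WeakDual ℝ X | p v ≤ 0} :=
    isClosed_le (WeakDual.eval_continuous v) continuous_const
  have hsub : toWD '' coneHull S ⊆ {p : WeakDual ℝ X | p v ≤ 0} := by
    rintro _ ⟨p, ⟨n, c, w, hc, hw, rfl⟩, rfl⟩
    change (∑ i, c i • w i : X →L[ℝ] ℝ) v ≤ 0
    simp only [sum_apply, smul_apply, smul_eq_mul]
    exact Finset.sum_nonpos fun i _ => mul_nonpos_of_nonneg_of_nonpos (hc i) (hv _ (hw i))
  exact closure_minimal hsub hcl ha

theorem s9_factor {X Y : Type*} [NormedAddCommGroup X] [NormedSpace ℝ X] [CompleteSpace X]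
    [NormedAddCommGroup Y] [NormedSpace ℝ Y] [CompleteSpace Y] (dh : X →L[ℝ] Y)
    (hsurj : Function.Surjective dh) (b : X →L[ℝ] ℝ) (hb : ∀ v, dh v = 0 → b v = 0) :
    b ∈ adjRange dh := by
  obtain ⟨R, -⟩ := ContinuousLinearMap.exists_nonlinearRightInverse_of_surjective dh
    (LinearMap.range_eq_top.2 hsurj)
  have key : ∀ x y, dh x = dh y → b x = b y := by
    intro x y hxy
    have := hb (x - y) (by simp [hxy])
    rw [map_sub] at this
    linarith
  have hR : ∀ y, dh (R y) = y := R.right_inv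
  refine ⟨LinearMap.mkContinuous
    { toFun := fun y => b (R y)
      map_add' := fun y z => by
        rw [← map_add]; apply key; simp [hR]
      map_smul' := fun c y => by
        rw [RingHom.id_apply, ← map_smul]; apply key; simp [hR] } (‖b‖ * R.nnnorm) ?_, ?_⟩
  · intro y
    calc ‖b (R y)‖ ≤ ‖b‖ * ‖R y‖ := b.le_opNorm _
      _ ≤ ‖b‖ * (R.nnnorm * ‖y‖) := by gcongr; exact R.bound y
      _ = _ := by ring
  · ext x
    exact key _ _ (hR _)

/-- Sum rule via the Riesz extension theorem. -/
theorem s9_riesz {X : Type*} [NormedAddCommGroup X] [NormedSpace ℝ X]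
    (K : PointedCone ℝ X) (L : Submodule ℝ X) (p : X →L[ℝ] ℝ)
    (hp : ∀ v ∈ K, v ∈ L → p v ≤ 0) (xt : X) (σ : ℝ) (hσ : 0 < σ) (hxt : xt ∈ L)
    (hK : ∀ x : X, ‖x‖ ≤ σ → xt + x ∈ K) :
    ∃ a : X →L[ℝ] ℝ, (∀ v ∈ L, a v = p v) ∧ ∀ v ∈ K, a v ≤ 0 := by
  obtain ⟨f, hf1, hf2⟩ := riesz_extension K
    ⟨L, (-(p : X →ₗ[ℝ] ℝ)).comp L.subtype⟩
    (fun x hx => by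
      have := hp x hx x.2
      simpa using this)
    (fun y => by
      have hpos : 0 < (‖y‖ + 1) / σ := by positivity
      refine ⟨⟨((‖y‖ + 1) / σ) • xt, L.smul_mem _ hxt⟩, ?_⟩
      have h1 : xt + (σ / (‖y‖ + 1)) • y ∈ K := by
        apply hK
        rw [norm_smul, Real.norm_of_nonneg (by positivity), div_mul_eq_mul_div,
          div_le_iff₀ (by positivity)]
        nlinarith [norm_nonneg y]
      have h2 := K.smul_mem hpos.le h1
      have h3 : ((‖y‖ + 1) / σ) • (xt + (σ / (‖y‖ + 1)) • y)
          = ((‖y‖ + 1) / σ) • xt + y := by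
        rw [smul_add, smul_smul, div_mul_div_cancel₀ hσ.ne', div_self (by positivity), one_smul]
      rw [← h3]; exact h2)
  have hbd : ∀ x : X, ‖x‖ ≤ σ → |f x| ≤ f xt := by
    intro x hx
    have h1 := hf2 _ (hK x hx)
    have h2 := hf2 _ (hK (-x) (by simpa using hx))
    simp only [map_add, map_neg] at h1 h2
    rw [abs_le]; constructor <;> linarith
  have hbd2 : ∀ x : X, ‖(-f) x‖ ≤ (f xt / σ) * ‖x‖ := by
    intro x
    rcases eq_or_ne x 0 with rfl | hx
    · simp
    have hx' : 0 < ‖x‖ := norm_pos_iff.2 hx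
    have := hbd ((σ / ‖x‖) • x) (by
      rw [norm_smul, Real.norm_of_nonneg (by positivity), div_mul_cancel₀ _ hx'.ne'])
    rw [map_smul, smul_eq_mul, abs_mul, abs_of_pos (by positivity : 0 < σ / ‖x‖)] at this
    rw [LinearMap.neg_apply, norm_neg, Real.norm_eq_abs]
    field_simp at this ⊢
    linarith
  refine ⟨(-f).mkContinuous _ hbd2, fun v hv => ?_, fun v hv => ?_⟩
  · have := hf1 ⟨v, hv⟩
    simp at this ⊢
    rw [this]
    change -(-(p v)) = p v
    ring
  · have := hf2 v hv
    simpa using this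

theorem s9_tangent {X Y T : Type*} [NormedAddCommGroup X] [NormedSpace ℝ X] [CompleteSpace X]
    [NormedAddCommGroup Y] [NormedSpace ℝ Y] [CompleteSpace Y]
    (g : T → X → ℝ) (dg : T → X →L[ℝ] ℝ) (h : X → Y) (dh : X →L[ℝ] Y) (xb : X)
    (hhd : HasStrictFDerivAt h dh xb)
    (hr : ∀ ε > (0:ℝ), ∃ η > (0:ℝ), ∀ t : T, ∀ x x' : X, ‖x - xb‖ ≤ η → ‖x' - xb‖ ≤ η →
      |g t x - g t x' - dg t (x - x')| ≤ ε * (‖dg t‖ * ‖x - x'‖))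
    (hsurj : Function.Surjective dh)
    (v : X) (hv : dh v = 0) (δ e : ℝ) (hδ : 0 < δ) (he : 0 < e)
    (hneg : ∀ t, -(e * ‖dg t‖) ≤ g t xb → dg t v ≤ -(δ * ‖dg t‖))
    (θ₀ : ℝ) (hθ₀ : 0 < θ₀) :
    ∃ η > (0:ℝ), ∀ x, h x = 0 → (∀ t, g t x ≤ 0) → ‖x - xb‖ < η → ∀ τ, 0 < τ → τ < η →
      ∃ u, h u = 0 ∧ (∀ t, g t u ≤ 0) ∧ ‖u - (x + τ • v)‖ ≤ θ₀ * τ := by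
  obtain ⟨θ, hθ, hθθ, hθ1, hθδ⟩ : ∃ θ > 0, θ ≤ θ₀ ∧ θ ≤ 1 ∧ θ ≤ δ / 2 :=
    ⟨min θ₀ (min 1 (δ / 2)), by positivity, min_le_left _ _,
      (min_le_right _ _).trans (min_le_left _ _), (min_le_right _ _).trans (min_le_right _ _)⟩
  obtain ⟨r, hr0, hr1, hrδ⟩ : ∃ r > 0, r ≤ 1 ∧ r * (‖v‖ + 1) ≤ δ / 2 :=
    ⟨min 1 (δ / 2 / (‖v‖ + 1)), by positivity, min_le_left _ _, by
      rw [← le_div_iff₀ (by positivity)]; exact min_le_right _ _⟩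
  obtain ⟨ρ, hρ, hrρ⟩ := hr r hr0
  obtain ⟨R, hR⟩ := ContinuousLinearMap.exists_nonlinearRightInverse_of_surjective dh
    (LinearMap.range_eq_top.2 hsurj)
  have hN : 0 < (R.nnnorm : ℝ)⁻¹ := inv_pos.2 (by exact_mod_cast hR)
  set N : ℝ := (R.nnnorm : ℝ)⁻¹ with hNdef
  have hc0 : 0 < N * θ / (‖v‖ + 1) := by positivity
  obtain ⟨c, hc⟩ : ∃ c : NNReal, (c : ℝ) = N * θ / (‖v‖ + 1) := ⟨⟨_, hc0.le⟩, rfl⟩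
  obtain ⟨s, hs, happ⟩ := hhd.approximates_deriv_on_nhds (c := c)
    (Or.inr (by rw [← NNReal.coe_pos, hc]; exact hc0))
  obtain ⟨ρ', hρ', hball⟩ := Metric.mem_nhds_iff.1 hs
  obtain ⟨M, hM, hM1, hM2, hM3⟩ : ∃ M > 0, M ≤ ρ ∧ M < ρ' ∧ M ≤ e / 2 :=
    ⟨min ρ (min (ρ' / 2) (e / 2)), by positivity, min_le_left _ _,
      ((min_le_right _ _).trans (min_le_left _ _)).trans_lt (by linarith),
      (min_le_right _ _).trans (min_le_right _ _)⟩
  have hvn := norm_nonneg v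
  refine ⟨M / (‖v‖ + 2), by positivity, fun x hx0 hxg hxM τ hτ hτM => ?_⟩
  rw [lt_div_iff₀ (by positivity)] at hxM hτM
  have hnear : ∀ u, ‖u - (x + τ • v)‖ ≤ θ * τ → ‖u - xb‖ ≤ M ∧ ‖u - x‖ ≤ τ * (‖v‖ + 1) := by
    intro u hu
    have h1 : ‖u - x‖ ≤ τ * (‖v‖ + 1) := by
      have : u - x = (u - (x + τ • v)) + τ • v := by abel
      rw [this]
      refine (norm_add_le _ _).trans ?_
      rw [norm_smul, Real.norm_of_nonneg hτ.le]
      nlinarith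
    refine ⟨?_, h1⟩
    have : u - xb = (u - x) + (x - xb) := by abel
    rw [this]
    refine (norm_add_le _ _).trans ?_
    have hxn := norm_nonneg (x - xb)
    nlinarith
  have hins : ∀ u, ‖u - xb‖ ≤ M → u ∈ s := fun u hu => hball (by
    rw [Metric.mem_ball, dist_eq_norm]; linarith)
  have hxM' : ‖x - xb‖ ≤ M := by nlinarith [norm_nonneg (x - xb)]
  have hb : ‖x + τ • v - (x + τ • v)‖ ≤ θ * τ := by simp; positivity
  have hsur := happ.surjOn_closedBall_of_nonlinearRightInverse R (ε := θ * τ) (b := x + τ • v)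
    (by positivity) (fun u hu => hins u (hnear u (by
      rwa [Metric.mem_closedBall, dist_eq_norm] at hu)).1)
  have h0 : (0 : Y) ∈ Metric.closedBall (h (x + τ • v)) (((R.nnnorm : ℝ)⁻¹ - c) * (θ * τ)) := by
    rw [Metric.mem_closedBall, dist_comm, dist_zero_right, ← hNdef]
    have := happ _ (hins _ (hnear _ hb).1) _ (hins _ hxM')
    rw [hx0, sub_zero, add_sub_cancel_left, map_smul, hv, smul_zero, sub_zero, norm_smul,
      Real.norm_of_nonneg hτ.le] at this
    refine this.trans ?_
    have hcv : (c : ℝ) * (‖v‖ + 1) = N * θ := by rw [hc]; field_simp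
    have hcpos : (0:ℝ) ≤ c := c.2
    have : (c : ℝ) * ‖v‖ ≤ (N - c) * θ := by nlinarith
    nlinarith
  obtain ⟨u, hu, hu0⟩ := hsur h0
  rw [Metric.mem_closedBall, dist_eq_norm] at hu
  obtain ⟨huM, hux⟩ := hnear u hu
  refine ⟨u, hu0, fun t => ?_, hu.trans (by gcongr)⟩
  have hdn := norm_nonneg (dg t)
  by_cases ht : -(e * ‖dg t‖) ≤ g t xb
  · have h1 := (abs_le.1 (hrρ t u x (huM.trans hM1) (hxM'.trans hM1))).2
    have h2 : dg t (u - x) = dg t (u - (x + τ • v)) + τ * dg t v := by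
      rw [← smul_eq_mul, ← map_smul, ← map_add]; congr 1; abel
    have h3 : dg t (u - (x + τ • v)) ≤ ‖dg t‖ * (θ * τ) :=
      (le_abs_self _).trans (((dg t).le_opNorm _).trans (by gcongr))
    have h4 := mul_le_mul_of_nonneg_left (hneg t ht) hτ.le
    have h5 : r * (‖dg t‖ * ‖u - x‖) ≤ r * (‖dg t‖ * (τ * (‖v‖ + 1))) := by gcongr
    have h6 : ‖dg t‖ * τ * (r * (‖v‖ + 1)) ≤ ‖dg t‖ * τ * (δ / 2) := by gcongr
    have h7 : ‖dg t‖ * τ * θ ≤ ‖dg t‖ * τ * (δ / 2) := by gcongr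
    have h8 := hxg t
    nlinarith
  · push Not at ht
    have h1 := (abs_le.1 (hrρ t u xb (huM.trans hM1) (by simpa using hρ.le))).2
    have h3 : dg t (u - xb) ≤ ‖dg t‖ * (e / 2) :=
      (le_abs_self _).trans (((dg t).le_opNorm _).trans (by gcongr; exact huM.trans hM3))
    have h5 : r * (‖dg t‖ * ‖u - xb‖) ≤ 1 * (‖dg t‖ * (e / 2)) := by
      gcongr; exact huM.trans hM3
    nlinarith

theorem s9_limiting {X Y T : Type*} [NormedAddCommGroup X] [NormedSpace ℝ X] [CompleteSpace X]
    [NormedAddCommGroup Y] [NormedSpace ℝ Y] [CompleteSpace Y]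
    (g : T → X → ℝ) (dg : T → X →L[ℝ] ℝ) (h : X → Y) (dh : X →L[ℝ] Y) (xb : X)
    (hhd : HasStrictFDerivAt h dh xb)
    (hr : ∀ ε > (0:ℝ), ∃ η > (0:ℝ), ∀ t : T, ∀ x x' : X, ‖x - xb‖ ≤ η → ‖x' - xb‖ ≤ η →
      |g t x - g t x' - dg t (x - x')| ≤ ε * (‖dg t‖ * ‖x - x'‖))
    (hsurj : Function.Surjective dh)
    (p : X →L[ℝ] ℝ) (hp : p ∈ limitingNormal {x : X | h x = 0 ∧ ∀ t : T, g t x ≤ 0} xb)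
    (v : X) (hv : dh v = 0) (δ e : ℝ) (hδ : 0 < δ) (he : 0 < e)
    (hneg : ∀ t, -(e * ‖dg t‖) ≤ g t xb → dg t v ≤ -(δ * ‖dg t‖)) : p v ≤ 0 := by
  obtain ⟨ε, xs, ps, hε0, hε, hxs, hxsl, hps, hpsl⟩ := hp
  obtain ⟨C, hC⟩ : ∃ C, ∀ n, ‖ps n‖ ≤ C := banach_steinhaus fun x => by
    obtain ⟨C, hC⟩ := (hpsl x).norm.bddAbove_range
    exact ⟨C, fun n => hC ⟨n, rfl⟩⟩
  have hC0 : 0 ≤ C := (norm_nonneg _).trans (hC 0)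
  have hvn := norm_nonneg v
  have key : ∀ θ > 0, p v ≤ C * θ + (0 + θ) * (‖v‖ + θ) := by
    intro θ hθ
    obtain ⟨η, hη, H⟩ := s9_tangent g dg h dh xb hhd hr hsurj v hv δ e hδ he hneg θ hθ
    have hlim : Tendsto (fun n => C * θ + (ε n + θ) * (‖v‖ + θ)) atTop
        (𝓝 (C * θ + (0 + θ) * (‖v‖ + θ))) :=
      tendsto_const_nhds.add ((hε.add tendsto_const_nhds).mul tendsto_const_nhds)
    refine le_of_tendsto_of_tendsto (hpsl v) hlim ?_
    filter_upwards [hxsl (Metric.ball_mem_nhds xb hη)] with n hn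
    have hn' : ‖xs n - xb‖ < η := by simpa [dist_eq_norm] using hn
    obtain ⟨d, hd, hd'⟩ := hps n θ hθ
    obtain ⟨τ, hτ, hτη, hτd⟩ : ∃ τ > 0, τ < η ∧ τ * (‖v‖ + θ) < d := by
      refine ⟨min (η / 2) (d / 2 / (‖v‖ + θ)), by positivity,
        (min_le_left _ _).trans_lt (by linarith), ?_⟩
      have : min (η / 2) (d / 2 / (‖v‖ + θ)) * (‖v‖ + θ) ≤ d / 2 := by
        rw [← le_div_iff₀ (by positivity)]; exact min_le_right _ _
      linarith
    obtain ⟨u, hu0, hug, hu⟩ := H (xs n) (hxs n).1 (hxs n).2 hn' τ hτ hτη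
    have hux : ‖u - xs n‖ ≤ τ * (‖v‖ + θ) := by
      have : u - xs n = (u - (xs n + τ • v)) + τ • v := by abel
      rw [this]
      refine (norm_add_le _ _).trans ?_
      rw [norm_smul, Real.norm_of_nonneg hτ.le]
      nlinarith
    have h1 := hd' u ⟨hu0, hug⟩ (hux.trans_lt hτd)
    have h2 : ps n (u - xs n) = ps n (u - (xs n + τ • v)) + τ * ps n v := by
      rw [← smul_eq_mul, ← map_smul, ← map_add]; congr 1; abel
    have h3 : |ps n (u - (xs n + τ • v))| ≤ C * (θ * τ) :=
      ((ps n).le_opNorm _).trans (mul_le_mul (hC n) hu (norm_nonneg _) hC0)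
    have h4 := (abs_le.1 h3).1
    have h5 : (ε n + θ) * ‖u - xs n‖ ≤ (ε n + θ) * (τ * (‖v‖ + θ)) := by
      have := hε0 n
      gcongr
    have h6 : τ * ps n v ≤ τ * (C * θ + (ε n + θ) * (‖v‖ + θ)) := by nlinarith
    exact le_of_mul_le_mul_left h6 hτ
  have hlim : Tendsto (fun θ : ℝ => C * θ + (0 + θ) * (‖v‖ + θ)) (𝓝[>] 0) (𝓝 0) := by
    have : Continuous (fun θ : ℝ => C * θ + (0 + θ) * (‖v‖ + θ)) := by fun_prop
    have h2 := (this.tendsto 0).mono_left (nhdsWithin_le_nhds (s := Set.Ioi 0))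
    simpa using h2
  refine ge_of_tendsto hlim ?_
  filter_upwards [self_mem_nhdsWithin] with θ hθ using key θ hθ

theorem s9_slater {X : Type*} [NormedAddCommGroup X] [NormedSpace ℝ X] (a : X →L[ℝ] ℝ) (xt : X)
    (σ : ℝ) (hσ : 0 < σ) (ha : ∀ x : X, ‖x‖ ≤ σ → a (xt + x) ≤ 0) : a xt ≤ -(σ * ‖a‖) := by
  have hxt : a xt ≤ 0 := by simpa using ha 0 (by simpa using hσ.le)
  have : ‖a‖ ≤ (-a xt) / σ := by
    refine a.opNorm_le_bound (div_nonneg (by linarith) hσ.le) fun x => ?_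
    rcases eq_or_ne x 0 with rfl | hx
    · simp
    have hx' : 0 < ‖x‖ := norm_pos_iff.2 hx
    have hn : ‖(σ / ‖x‖) • x‖ ≤ σ := by
      rw [norm_smul, Real.norm_of_nonneg (by positivity), div_mul_cancel₀ _ hx'.ne']
    have h1 := ha _ hn
    have h2 := ha (-((σ / ‖x‖) • x)) (by rwa [norm_neg])
    simp only [map_add, map_neg, map_smul, smul_eq_mul] at h1 h2
    have h3 : |σ / ‖x‖ * a x| ≤ -a xt := abs_le.2 ⟨by linarith, by linarith⟩
    rw [abs_mul, abs_of_pos (by positivity : 0 < σ / ‖x‖)] at h3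
    rw [Real.norm_eq_abs]
    field_simp at h3 ⊢
    linarith
  rw [le_div_iff₀ hσ] at this
  linarith

/-- unbounded gradients: assume (a) each `g t` is Fréchet differentiable at
`xb ∈ Ω` with `‖dg t‖ > 0`, and `h` is strictly differentiable at `xb`; (b) the normalized
uniform strict differentiability estimate `r̃(η) → 0`; (c) `∇h(xb)` is surjective and for some
`ε > 0` there are `xt` and `σ > 0` with `∇h(xb) xt = 0` and `⟨dg t, xt + x⟩ ≤ 0` whenever
`‖x‖ ≤ σ` and `t ∈ T̃_ε(xb) = {t | g t xb ≥ -ε‖dg t‖}`. Then the limiting normal cone to `Ω`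
at `xb` equals `⋂_{ε>0} cl* cone{dg t : t ∈ T̃_ε(xb)} + ∇h(xb)*(Y*)`. -/
theorem statement9 {X Y T : Type*} [NormedAddCommGroup X] [NormedSpace ℝ X] [CompleteSpace X]
    [NormedAddCommGroup Y] [NormedSpace ℝ Y] [CompleteSpace Y]
    (g : T → X → ℝ) (dg : T → X →L[ℝ] ℝ) (h : X → Y) (dh : X →L[ℝ] Y) (xb : X)
    (hgd : ∀ t : T, HasFDerivAt (g t) (dg t) xb)
    (hpos : ∀ t : T, 0 < ‖dg t‖)
    (hhd : HasStrictFDerivAt h dh xb)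
    (hxb : xb ∈ {x : X | h x = 0 ∧ ∀ t : T, g t x ≤ 0})
    (hr : ∀ ε > (0:ℝ), ∃ η > (0:ℝ), ∀ t : T, ∀ x x' : X, ‖x - xb‖ ≤ η → ‖x' - xb‖ ≤ η →
      |g t x - g t x' - dg t (x - x')| ≤ ε * (‖dg t‖ * ‖x - x'‖))
    (hsurj : Function.Surjective dh)
    (hc : ∃ ε > (0:ℝ), ∃ xt : X, ∃ σ > (0:ℝ), dh xt = 0 ∧
      ∀ t : T, -(ε * ‖dg t‖) ≤ g t xb → ∀ x : X, ‖x‖ ≤ σ → dg t (xt + x) ≤ 0) :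
    limitingNormal {x : X | h x = 0 ∧ ∀ t : T, g t x ≤ 0} xb =
      (⋂ ε > (0:ℝ), wkClosure (coneHull (dg '' {t : T | -(ε * ‖dg t‖) ≤ g t xb}))) +
        adjRange dh := by
  obtain ⟨e₀, he₀, xt, σ, hσ, hxt0, hxt⟩ := hc
  have hslater : ∀ t : T, -(e₀ * ‖dg t‖) ≤ g t xb → dg t xt ≤ -(σ * ‖dg t‖) :=
    fun t ht => s9_slater (dg t) xt σ hσ (hxt t ht)
  apply Set.Subset.antisymm
  · intro p hp
    let K : PointedCone ℝ X :=
      { carrier := {v | ∃ e > (0:ℝ), ∀ t, -(e * ‖dg t‖) ≤ g t xb → dg t v ≤ 0}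
        zero_mem' := ⟨1, one_pos, fun t _ => by simp⟩
        add_mem' := by
          rintro v w ⟨e, he, hv⟩ ⟨e', he', hw⟩
          refine ⟨min e e', by positivity, fun t ht => ?_⟩
          have h1 : min e e' * ‖dg t‖ ≤ e * ‖dg t‖ := by gcongr; exact min_le_left _ _
          have h2 : min e e' * ‖dg t‖ ≤ e' * ‖dg t‖ := by gcongr; exact min_le_right _ _
          rw [map_add]
          exact add_nonpos (hv t (by linarith)) (hw t (by linarith))
        smul_mem' := by
          rintro c v ⟨e, he, hv⟩
          refine ⟨e, he, fun t ht => ?_⟩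
          have : dg t ((c : ℝ) • v) ≤ 0 := by
            rw [map_smul]
            exact mul_nonpos_of_nonneg_of_nonpos c.2 (hv t ht)
          exact this }
    have hpK : ∀ v ∈ K, v ∈ dh.ker → p v ≤ 0 := by
      rintro v ⟨e, he, hv⟩ hvL
      have hvL' : dh v = 0 := hvL
      have key : ∀ s > 0, p v + s * p xt ≤ 0 := by
        intro s hs
        have := s9_limiting g dg h dh xb hhd hr hsurj p hp (v + s • xt)
          (by simp [hvL', hxt0]) (s * σ) (min e e₀) (by positivity) (by positivity)
          (fun t ht => by
            have h1 : min e e₀ * ‖dg t‖ ≤ e * ‖dg t‖ := by gcongr; exact min_le_left _ _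
            have h2 : min e e₀ * ‖dg t‖ ≤ e₀ * ‖dg t‖ := by gcongr; exact min_le_right _ _
            have h3 := hv t (by linarith)
            have h4 := mul_le_mul_of_nonneg_left (hslater t (by linarith)) hs.le
            rw [map_add, map_smul, smul_eq_mul]
            linarith)
        simpa using this
      have hlim : Tendsto (fun s : ℝ => p v + s * p xt) (𝓝[>] 0) (𝓝 (p v)) := by
        have : Continuous (fun s : ℝ => p v + s * p xt) := by fun_prop
        have h2 := (this.tendsto 0).mono_left (nhdsWithin_le_nhds (s := Set.Ioi 0))
        simpa using h2
      refine le_of_tendsto hlim ?_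
      filter_upwards [self_mem_nhdsWithin] with s hs using key s hs
    obtain ⟨a, haL, haK⟩ := s9_riesz K dh.ker p hpK xt σ hσ hxt0
      (fun x hx => ⟨e₀, he₀, fun t ht => hxt t ht x hx⟩)
    refine ⟨a, ?_, p - a, ?_, by simp⟩
    · simp only [Set.mem_iInter]
      intro e he
      refine s9_bipolar _ _ fun v hv => haK v ⟨e, he, fun t ht => hv _ ⟨t, ht, rfl⟩⟩
    · refine s9_factor dh hsurj _ fun v hv => ?_
      have := haL v hv
      simp [this]
  · rintro _ ⟨a, ha, _, ⟨q, rfl⟩, rfl⟩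
    simp only [Set.mem_iInter] at ha
    refine ⟨fun _ => 0, fun _ => xb, fun _ => a + q.comp dh, fun _ => le_rfl, tendsto_const_nhds,
      fun _ => hxb, tendsto_const_nhds, fun _ => ?_, fun v => tendsto_const_nhds⟩
    intro γ hγ
    obtain ⟨r, hr0, hrγ⟩ : ∃ r > 0, 2 * r / σ * |a xt| ≤ γ / 2 := by
      refine ⟨σ * γ / (4 * (|a xt| + 1)), by positivity, ?_⟩
      have : 0 ≤ |a xt| := abs_nonneg _
      rw [div_mul_eq_mul_div, div_le_iff₀ hσ]
      have : 2 * (σ * γ / (4 * (|a xt| + 1))) * |a xt|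
          = (γ / 2 * σ) * (|a xt| / (|a xt| + 1)) := by field_simp; ring
      rw [this]
      have h1 : |a xt| / (|a xt| + 1) ≤ 1 := by
        rw [div_le_one (by positivity)]; linarith
      have h2 : 0 ≤ γ / 2 * σ := by positivity
      nlinarith
    obtain ⟨c, hc0, hcγ⟩ : ∃ c > 0, ‖q‖ * c ≤ γ / 2 := by
      refine ⟨γ / 2 / (‖q‖ + 1), by positivity, ?_⟩
      rw [mul_div_assoc', div_le_iff₀ (by positivity)]
      nlinarith [norm_nonneg q]
    obtain ⟨η, hη, hrη⟩ := hr r hr0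
    obtain ⟨η', hη', hhη⟩ := Metric.eventually_nhds_iff.1 (hhd.hasFDerivAt.isLittleO.def hc0)
    have hmin : 0 < min (min η η') (e₀ / r) := by positivity
    refine ⟨min (min η η') (e₀ / r), hmin, fun u hu hud => ?_⟩
    have hu1 : ‖u - xb‖ < η := hud.trans_le ((min_le_left _ _).trans (min_le_left _ _))
    have hu2 : ‖u - xb‖ < η' := hud.trans_le ((min_le_left _ _).trans (min_le_right _ _))
    have hu3 : ‖u - xb‖ < e₀ / r := hud.trans_le (min_le_right _ _)
    rw [lt_div_iff₀ hr0] at hu3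
    rcases eq_or_ne u xb with rfl | hne
    · simp
    have hun : 0 < ‖u - xb‖ := norm_pos_iff.2 (sub_ne_zero.2 hne)
    have hA : a ((u - xb) + (2 * r / σ * ‖u - xb‖) • xt) ≤ 0 := by
      refine s9_bipolar_easy _ a (ha (r * ‖u - xb‖) (by positivity)) _ ?_
      rintro _ ⟨t, ht, rfl⟩
      have ht' : -(r * ‖u - xb‖ * ‖dg t‖) ≤ g t xb := ht
      have hdn := hpos t
      have h0 : r * ‖u - xb‖ * ‖dg t‖ ≤ e₀ * ‖dg t‖ := by gcongr; linarith
      have h1 := (abs_le.1 (hrη t u xb hu1.le (by simpa using hη.le))).1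
      have h2 := hu.2 t
      have h3 := mul_le_mul_of_nonneg_left (hslater t (by linarith))
        (by positivity : 0 ≤ 2 * r / σ * ‖u - xb‖)
      have h4 : 2 * r / σ * ‖u - xb‖ * -(σ * ‖dg t‖) = -(2 * r * ‖u - xb‖ * ‖dg t‖) := by
        field_simp
      rw [map_add, map_smul, smul_eq_mul]
      linarith
    have hB : ‖dh (u - xb)‖ ≤ c * ‖u - xb‖ := by
      have := hhη (y := u) (by rwa [dist_eq_norm])
      rwa [hu.1, hxb.1, sub_zero, zero_sub, norm_neg] at this
    have hC : q (dh (u - xb)) ≤ ‖q‖ * (c * ‖u - xb‖) :=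
      (le_abs_self _).trans ((q.le_opNorm _).trans (by gcongr))
    rw [map_add, map_smul, smul_eq_mul] at hA
    have hD : -(2 * r / σ * ‖u - xb‖ * a xt) ≤ γ / 2 * ‖u - xb‖ := by
      have h1 : 2 * r / σ * (-a xt) ≤ 2 * r / σ * |a xt| := by
        gcongr; exact neg_le_abs _
      nlinarith
    have hE : ‖q‖ * c * ‖u - xb‖ ≤ γ / 2 * ‖u - xb‖ := by gcongr
    change a (u - xb) + q (dh (u - xb)) ≤ (0 + γ) * ‖u - xb‖
    linarith
end
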